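/- arXiv:1507.06195 — 3 statements merged into one kernel-verified Lean document; each statement's English description precedes it below -/
import Mathlib

section
/- Let g be holomorphic on Δ* × Δ^k (punctured disk times polydisk, k ≥ 0) such that g, as a function of the first variable with the others fixed, is square integrable near {0} × Δ^k. If g ∈ L²_loc(Δ^{k+1}), then g extends holomorphically to Δ^{k+1}. -/
open Metric Set MeasureTheory
open scoped ENNReal Real Topology

lemma aux_circle {q : ℂ → ℂ} {R : ℝ} (hq : DifferentiableOn ℂ q (closedBall 0 R))
    {w : ℂ} (hw : w ∈ ball (0:ℂ) R) :
    ENNReal.ofReal (2 * π) * ‖q 0‖ₑ ≤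
      ∫⁻ θ in Ioc 0 (2 * π), ‖q (circleMap 0 1 θ * w)‖ₑ := by
  have hmaps : MapsTo (fun ζ : ℂ => ζ * w) (closedBall 0 1) (closedBall 0 R) := by
    intro ζ hζ
    simp only [mem_closedBall, dist_zero_right, norm_mul] at *
    have h2 : ‖w‖ < R := by simpa using hw
    nlinarith [norm_nonneg w]
  have h1 : DifferentiableOn ℂ (fun ζ : ℂ => q (ζ * w)) (closedBall 0 1) :=
    hq.comp (by fun_prop) hmaps
  have h2 : DiffContOnCl ℂ (fun ζ : ℂ => q (ζ * w)) (ball 0 |1|) := by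
    rw [abs_one]
    exact ⟨h1.mono ball_subset_closedBall, h1.continuousOn.mono (closure_ball_subset_closedBall)⟩
  have h3 := h2.circleAverage
  simp only [Real.circleAverage, zero_mul] at h3
  have h4 : (∫ θ in (0:ℝ)..2 * π, q (circleMap 0 1 θ * w)) = (2 * π) • q 0 := by
    rw [← h3, smul_smul, mul_inv_cancel₀ (by positivity), one_smul]
  rw [intervalIntegral.integral_of_le (by positivity)] at h4
  have h5 := enorm_integral_le_lintegral_enorm (μ := volume.restrict (Ioc 0 (2 * π)))
    (fun θ => q (circleMap 0 1 θ * w))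
  rw [h4, enorm_smul, Real.enorm_eq_ofReal (by positivity)] at h5
  exact h5

lemma aux_area0 {q : ℂ → ℂ} {R : ℝ} (hq : DifferentiableOn ℂ q (closedBall 0 R)) :
    ‖q 0‖ₑ * volume (ball (0:ℂ) R) ≤ ∫⁻ z in ball (0:ℂ) R, ‖q z‖ₑ := by
  set F : ℂ → ℝ≥0∞ := (ball (0:ℂ) R).indicator (fun z => ‖q z‖ₑ) with hF
  have hFm : Measurable F := by
    have hc : ContinuousOn (fun z => ‖q z‖ₑ) (ball (0:ℂ) R) :=
      (hq.continuousOn.mono ball_subset_closedBall).enorm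
    classical
    rw [hF, ← piecewise_eq_indicator]
    exact hc.measurable_piecewise continuousOn_const measurableSet_ball
  have hpi : ENNReal.ofReal (2 * π) ≠ 0 := by simp [Real.pi_pos]
  have key : ENNReal.ofReal (2 * π) * (‖q 0‖ₑ * volume (ball (0:ℂ) R)) ≤
      ENNReal.ofReal (2 * π) * ∫⁻ z in ball (0:ℂ) R, ‖q z‖ₑ := by
    calc ENNReal.ofReal (2 * π) * (‖q 0‖ₑ * volume (ball (0:ℂ) R))
        = ∫⁻ w in ball (0:ℂ) R, ENNReal.ofReal (2 * π) * ‖q 0‖ₑ := by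
          rw [setLIntegral_const, mul_assoc]
      _ ≤ ∫⁻ w in ball (0:ℂ) R, ∫⁻ θ in Ioc 0 (2 * π), F (circleMap 0 1 θ * w) := by
          refine setLIntegral_mono' measurableSet_ball fun w hw => ?_
          refine (aux_circle hq hw).trans (le_of_eq ?_)
          refine lintegral_congr fun θ => ?_
          have : circleMap 0 1 θ * w ∈ ball (0:ℂ) R := by simpa using hw
          simp only [hF, indicator_of_mem this]
      _ = ∫⁻ θ in Ioc 0 (2 * π), ∫⁻ w in ball (0:ℂ) R, F (circleMap 0 1 θ * w) := by
          refine lintegral_lintegral_swap (Measurable.aemeasurable ?_)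
          refine hFm.comp ?_
          have : Continuous (fun p : ℂ × ℝ => circleMap 0 1 p.2 * p.1) := by fun_prop
          exact this.measurable
      _ ≤ ∫⁻ θ in Ioc 0 (2 * π), ∫⁻ w, F w := by
          refine lintegral_mono fun θ => ?_
          refine (setLIntegral_le_lintegral _ _).trans (le_of_eq ?_)
          have := (LinearIsometryEquiv.measurePreserving (rotation (Circle.exp θ))).lintegral_comp hFm
          rw [← this]
          simp [rotation_apply, circleMap]
      _ = _ := by
          rw [setLIntegral_const, Real.volume_Ioc, sub_zero, mul_comm, hF,
            lintegral_indicator measurableSet_ball]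
  exact (ENNReal.mul_le_mul_iff_right hpi ENNReal.ofReal_ne_top).1 key

lemma aux_area {q : ℂ → ℂ} {c : ℂ} {R : ℝ} (hq : DifferentiableOn ℂ q (closedBall c R)) :
    ‖q c‖ₑ * volume (ball (0:ℂ) R) ≤ ∫⁻ z in ball c R, ‖q z‖ₑ := by
  have h := aux_area0 (q := fun z => q (z + c)) (R := R) (hq.comp (by fun_prop) (by
    intro z hz; simpa using hz))
  simp only [zero_add] at h
  refine h.trans (le_of_eq ?_)
  have := (measurePreserving_add_right (volume : Measure ℂ) c).setLIntegral_comp_emb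
    (MeasurableEquiv.addRight c).measurableEmbedding (fun z => ‖q z‖ₑ) (ball 0 R)
  rw [this]
  simp

lemma aux_littleO {f : ℂ → ℂ} {r : ℝ} (hr : 0 < r) (hf : DifferentiableOn ℂ f (ball 0 1 \ {0}))
    (hi : IntegrableOn (fun t : ℂ => ‖f t‖ ^ 2) (ball (0 : ℂ) r \ {0})) :
    (fun z => f z - f 0) =o[𝓝[≠] 0] fun z => (z - 0)⁻¹ := by
  have hlim : Filter.Tendsto (fun z : ℂ => ∫⁻ t in ball (0:ℂ) (2 * ‖z‖),
      ‖f t ^ 2‖ₑ ∂(volume.restrict (ball (0 : ℂ) r \ {0}))) (𝓝[≠] 0) (𝓝 0) := by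
    refine tendsto_setLIntegral_zero ?_ ?_
    · have h := hi.2
      rw [hasFiniteIntegral_iff_enorm] at h
      simpa [enorm_pow] using h.ne
    · have h0 : Filter.Tendsto (fun z : ℂ => volume (ball (0:ℂ) (2 * ‖z‖))) (𝓝[≠] 0) (𝓝 0) := by
        simp only [Complex.volume_ball]
        have hc : Continuous (fun z : ℂ => ENNReal.ofReal (2 * ‖z‖) ^ 2 * (NNReal.pi : ℝ≥0∞)) :=
          ENNReal.continuous_mul_const (by simp) |>.comp
            ((ENNReal.continuous_pow 2).comp (ENNReal.continuous_ofReal.comp (by fun_prop)))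
        have := hc.tendsto 0
        simp only [norm_zero, mul_zero, ENNReal.ofReal_zero] at this
        simpa using this.mono_left nhdsWithin_le_nhds
      exact tendsto_of_tendsto_of_tendsto_of_le_of_le tendsto_const_nhds h0
        (fun _ => zero_le) (fun _ => Measure.restrict_apply_le _ _)
  have hb : ∀ᶠ z in 𝓝[≠] (0:ℂ), ‖(z * f z) ^ 2‖ₑ * (ENNReal.ofReal (1/4) * (NNReal.pi : ℝ≥0∞)) ≤
      ∫⁻ t in ball (0:ℂ) (2 * ‖z‖), ‖f t ^ 2‖ₑ ∂(volume.restrict (ball (0 : ℂ) r \ {0})) := by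
    have hs : ball (0:ℂ) (min (r/2) (1/2)) ∈ 𝓝 (0:ℂ) := ball_mem_nhds _ (by positivity)
    filter_upwards [self_mem_nhdsWithin, mem_nhdsWithin_of_mem_nhds hs] with z hz hz2
    have hz0 : 0 < ‖z‖ := by simpa using hz
    rw [mem_ball_zero_iff, lt_min_iff] at hz2
    have hlow : ∀ t ∈ closedBall z (‖z‖ / 2), 0 < ‖t‖ ∧ ‖t‖ < 2 * ‖z‖ := by
      intro t ht
      rw [mem_closedBall, dist_eq_norm] at ht
      have h1 := norm_sub_norm_le t z
      have h2 := norm_sub_norm_le z t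
      rw [norm_sub_rev] at h2
      constructor <;> linarith
    have hd : DifferentiableOn ℂ (fun t => f t ^ 2) (closedBall z (‖z‖ / 2)) := by
      refine (hf.mono ?_).pow 2
      intro t ht
      obtain ⟨h1, h2⟩ := hlow t ht
      refine ⟨?_, by simpa using h1⟩
      rw [mem_ball_zero_iff]; linarith
    have h := aux_area hd
    rw [Measure.restrict_restrict measurableSet_ball]
    refine le_trans (le_trans (le_of_eq ?_) h) (lintegral_mono_set ?_)
    · rw [Complex.volume_ball, mul_pow, enorm_mul, mul_comm ‖z ^ 2‖ₑ, mul_assoc, ← mul_assoc ‖z ^ 2‖ₑ]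
      congr 2
      rw [enorm_pow, ← ofReal_norm, ← ENNReal.ofReal_pow (by positivity),
        ← ENNReal.ofReal_pow (by positivity), ← ENNReal.ofReal_mul (by positivity)]
      congr 1; ring
    · intro t ht
      obtain ⟨h1, h2⟩ := hlow t (ball_subset_closedBall ht)
      refine ⟨by simpa using h2, ?_, by simpa using h1⟩
      rw [mem_ball_zero_iff]; linarith
  have hc0 : ENNReal.ofReal (1/4) * (NNReal.pi : ℝ≥0∞) ≠ 0 := by
    simp [NNReal.pi_ne_zero]
  have hct : ENNReal.ofReal (1/4) * (NNReal.pi : ℝ≥0∞) ≠ ∞ :=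
    ENNReal.mul_ne_top ENNReal.ofReal_ne_top (by simp)
  have h1 : Filter.Tendsto (fun z : ℂ => ‖(z * f z) ^ 2‖ₑ) (𝓝[≠] 0) (𝓝 0) := by
    have h2 := tendsto_of_tendsto_of_tendsto_of_le_of_le' tendsto_const_nhds hlim
      (Filter.Eventually.of_forall fun _ => zero_le) hb
    have h3 := ENNReal.Tendsto.mul_const (b := (ENNReal.ofReal (1/4) * (NNReal.pi : ℝ≥0∞))⁻¹) h2
      (Or.inr (ENNReal.inv_ne_top.2 hc0))
    simpa only [mul_assoc, ENNReal.mul_inv_cancel hc0 hct, mul_one, zero_mul] using h3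
  have h2 : Filter.Tendsto (fun z : ℂ => z * f z) (𝓝[≠] 0) (𝓝 0) := by
    rw [tendsto_zero_iff_enorm_tendsto_zero]
    have h3 := ((ENNReal.continuous_rpow_const (y := 1/2)).tendsto 0).comp h1
    rw [ENNReal.zero_rpow_of_pos (by norm_num)] at h3
    refine h3.congr fun z => ?_
    simp only [Function.comp, enorm_pow]
    rw [← ENNReal.rpow_natCast, ← ENNReal.rpow_mul]
    norm_num
  rw [Asymptotics.isLittleO_iff_tendsto']
  · have h3 : Filter.Tendsto (fun z : ℂ => z * f 0) (𝓝[≠] 0) (𝓝 0) := by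
      have : Continuous (fun z : ℂ => z * f 0) := by fun_prop
      simpa using (this.tendsto 0).mono_left nhdsWithin_le_nhds
    have h4 := h2.sub h3
    rw [sub_zero] at h4
    refine h4.congr fun z => ?_
    simp; ring
  · filter_upwards [self_mem_nhdsWithin] with z hz h
    simp at h
    exact absurd h hz

lemma aux_param {E : Type*} [NormedAddCommGroup E] [NormedSpace ℂ E] [FiniteDimensional ℂ E]
    {V : Set (ℂ × E)} (hV : IsOpen V) {H : ℂ × E → ℂ} (hH : DifferentiableOn ℂ H V)
    {ρ : ℝ} (hρ : 0 ≤ ρ) {x₀ : E} (hx : ∀ s ∈ sphere (0:ℂ) ρ, (s, x₀) ∈ V) :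
    DifferentiableAt ℂ (fun z => ∮ s in C(0, ρ), H (s, z)) x₀ := by
  have : ProperSpace E := FiniteDimensional.proper ℂ E
  let _ : MeasurableSpace E := borel E
  have : BorelSpace E := ⟨rfl⟩
  obtain ⟨u, v, hu, hv, hsu, hxv, huv⟩ := generalized_tube_lemma (isCompact_sphere (0:ℂ) ρ)
    (isCompact_singleton (x := x₀)) hV (by rintro ⟨s, x⟩ ⟨hs, rfl⟩; exact hx s hs)
  obtain ⟨δ, hδ, hδv⟩ := nhds_basis_closedBall.mem_iff.1 (hv.mem_nhds (hxv rfl))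
  have hsub : sphere (0:ℂ) ρ ×ˢ closedBall x₀ δ ⊆ V :=
    (prod_mono hsu hδv).trans huv
  obtain ⟨M, hM⟩ := ((isCompact_sphere (0:ℂ) ρ).prod (isCompact_closedBall x₀ δ)).exists_bound_of_continuousOn
    (hH.continuousOn.mono hsub)
  have hcm : ∀ θ, circleMap 0 ρ θ ∈ sphere (0:ℂ) ρ := fun θ => circleMap_mem_sphere _ hρ _
  have hda : ∀ p ∈ V, DifferentiableAt ℂ H p := fun p hp => hH.differentiableAt (hV.mem_nhds hp)
  have hcont : ∀ x ∈ closedBall x₀ δ, Continuous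
      (fun θ : ℝ => deriv (circleMap 0 ρ) θ • H (circleMap 0 ρ θ, x)) := by
    intro x hx
    have h1 : Continuous (fun θ : ℝ => H (circleMap 0 ρ θ, x)) :=
      hH.continuousOn.comp_continuous (by fun_prop) (fun θ => hsub ⟨hcm θ, hx⟩)
    simp only [deriv_circleMap]
    have h2 : Continuous (fun θ : ℝ => circleMap 0 ρ θ * Complex.I) := by fun_prop
    exact Continuous.fun_smul h2 h1
  have hx₀ : x₀ ∈ closedBall x₀ δ := mem_closedBall_self hδ.le
  simp only [circleIntegral, intervalIntegral.integral_of_le Real.two_pi_pos.le]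
  refine (hasFDerivAt_integral_of_dominated_loc_of_lip' (μ := volume.restrict (Ioc 0 (2 * π)))
    (F := fun z θ => deriv (circleMap 0 ρ) θ • H (circleMap 0 ρ θ, z))
    (F' := fun θ => deriv (circleMap 0 ρ) θ •
      (fderiv ℂ H (circleMap 0 ρ θ, x₀)).comp (ContinuousLinearMap.inr ℂ ℂ E))
    (bound := fun θ => ρ * (2 * M / δ)) (s := ball x₀ δ)
    (ball_mem_nhds x₀ hδ) ?_ ?_ ?_ ?_ ?_ ?_).2.differentiableAt
  · exact fun x hx => (hcont x (ball_subset_closedBall hx)).aestronglyMeasurable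
  · exact ((hcont x₀ hx₀).integrableOn_Icc).mono_set Ioc_subset_Icc_self
  · refine AEStronglyMeasurable.fun_smul ?_ ?_
    · have h2 : Continuous (fun θ : ℝ => circleMap 0 ρ θ * Complex.I) := by fun_prop
      refine h2.aestronglyMeasurable.congr (Filter.Eventually.of_forall fun θ => ?_)
      simp [deriv_circleMap]
    · have h1 : Measurable (fun θ : ℝ => fderiv ℂ H (circleMap 0 ρ θ, x₀)) :=
        (measurable_fderiv ℂ H).comp
          (Continuous.measurable (by fun_prop : Continuous fun θ : ℝ => (circleMap 0 ρ θ, x₀)))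
      have h2 : Continuous (fun L : ℂ × E →L[ℂ] ℂ => L.comp (ContinuousLinearMap.inr ℂ ℂ E)) := by
        fun_prop
      exact h2.comp_aestronglyMeasurable h1.aestronglyMeasurable
  · refine Filter.Eventually.of_forall fun θ x hx => ?_
    have hd : DifferentiableOn ℂ (fun z => H (circleMap 0 ρ θ, z)) (ball x₀ δ) :=
      hH.comp (by fun_prop) (fun z hz => hsub ⟨hcm θ, ball_subset_closedBall hz⟩)
    have h := Complex.dist_le_div_mul_dist_of_mapsTo_ball (R₂ := 2 * M) hd (by
      intro z hz
      have h1 := hM (circleMap 0 ρ θ, z) ⟨hcm θ, ball_subset_closedBall hz⟩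
      have h2 := hM (circleMap 0 ρ θ, x₀) ⟨hcm θ, hx₀⟩
      rw [mem_closedBall, dist_eq_norm]
      exact (norm_sub_le _ _).trans (by linarith)) hx
    simp only [dist_eq_norm] at h
    rw [← smul_sub, norm_smul, mul_assoc]
    have : ‖deriv (circleMap 0 ρ) θ‖ = ρ := by simp [abs_of_nonneg hρ]
    rw [this]
    exact mul_le_mul_of_nonneg_left h hρ
  · exact integrable_const _
  · refine Filter.Eventually.of_forall fun θ => ?_
    have h1 := (hda (circleMap 0 ρ θ, x₀) (hsub ⟨hcm θ, hx₀⟩)).hasFDerivAt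
    have h2 := h1.comp x₀ (hasFDerivAt_prodMk_right (𝕜 := ℂ) (circleMap 0 ρ θ) x₀)
    exact h2.fun_const_smul _

/-- L² Riemann extension across the smooth hypersurface `{z₀ = 0}`: a holomorphic
function on `Δ* × Δᵏ` which is square integrable in the first variable near the
hypersurface and lies in `L²_loc` of the polydisk extends holomorphically to `Δ^{k+1}`. -/
theorem l2_riemann_extension (k : ℕ) (g : (Fin (k + 1) → ℂ) → ℂ)
    (hg : DifferentiableOn ℂ g
      {z : Fin (k + 1) → ℂ | (∀ i, z i ∈ ball (0 : ℂ) 1) ∧ z 0 ≠ 0})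
    (hslice : ∀ w : Fin k → ℂ, (∀ i, w i ∈ ball (0 : ℂ) 1) →
      ∃ r > 0, IntegrableOn (fun t : ℂ => ‖g (Fin.cons t w)‖ ^ 2)
        (ball (0 : ℂ) r \ {0}))
    (hL2 : LocallyIntegrableOn (fun z => ‖g z‖ ^ 2)
      {z : Fin (k + 1) → ℂ | ∀ i, z i ∈ ball (0 : ℂ) 1}) :
    ∃ G : (Fin (k + 1) → ℂ) → ℂ,
      DifferentiableOn ℂ G {z : Fin (k + 1) → ℂ | ∀ i, z i ∈ ball (0 : ℂ) 1} ∧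
      EqOn G g {z : Fin (k + 1) → ℂ | (∀ i, z i ∈ ball (0 : ℂ) 1) ∧ z 0 ≠ 0} := by
  have hopen : IsOpen {z : Fin (k + 1) → ℂ | ∀ i, z i ∈ ball (0 : ℂ) 1} := by
    simp only [Set.ofPred_forall]
    exact isOpen_iInter_of_finite fun i => isOpen_ball.preimage (continuous_apply i)
  have hopen' : IsOpen {z : Fin (k + 1) → ℂ | (∀ i, z i ∈ ball (0 : ℂ) 1) ∧ z 0 ≠ 0} :=
    hopen.inter (isOpen_ne.preimage (continuous_apply 0))
  set S : (Fin k → ℂ) → ℂ → ℂ := fun w =>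
    Function.update (fun t => g (Fin.cons t w)) 0 (Filter.limUnder (𝓝[≠] 0) (fun t => g (Fin.cons t w)))
    with hS
  have hcons : ∀ (w : Fin k → ℂ), (∀ i, w i ∈ ball (0 : ℂ) 1) → ∀ t ∈ ball (0:ℂ) 1,
      ∀ i, (Fin.cons t w : Fin (k + 1) → ℂ) i ∈ ball (0 : ℂ) 1 := by
    intro w hw t ht i
    refine Fin.cases ?_ (fun j => ?_) i
    · simpa using ht
    · simpa using hw j
  have hSd : ∀ w : Fin k → ℂ, (∀ i, w i ∈ ball (0 : ℂ) 1) →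
      DifferentiableOn ℂ (S w) (ball 0 1) := by
    intro w hw
    obtain ⟨r, hr, hi⟩ := hslice w hw
    have hd : DifferentiableOn ℂ (fun t : ℂ => g (Fin.cons t w)) (ball 0 1 \ {0}) := by
      refine hg.comp (t := {z : Fin (k + 1) → ℂ | (∀ i, z i ∈ ball (0 : ℂ) 1) ∧ z 0 ≠ 0}) ?_ ?_
      · refine differentiableOn_pi.2 fun i => ?_
        refine Fin.cases ?_ (fun j => ?_) i
        · simp only [Fin.cons_zero]; fun_prop
        · simp
      · intro t ht
        exact ⟨hcons w hw t ht.1, by simpa using ht.2⟩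
    exact Complex.differentiableOn_update_limUnder_of_isLittleO (ball_mem_nhds 0 one_pos) hd
      (aux_littleO hr hd hi)
  have hSg : ∀ z : Fin (k + 1) → ℂ, z 0 ≠ 0 → S (Fin.tail z) (z 0) = g z := by
    intro z hz
    simp [hS, Function.update_of_ne hz]
  refine ⟨fun z => S (Fin.tail z) (z 0), ?_, fun z hz => hSg z hz.2⟩
  intro z hz
  refine DifferentiableAt.differentiableWithinAt ?_
  by_cases hz0 : z 0 = 0
  · set V : Set (ℂ × (Fin (k + 1) → ℂ)) := {p | (p.1 ∈ ball (0:ℂ) 1 ∧ p.1 ≠ 0) ∧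
      (p.1 - p.2 0 ≠ 0 ∧ ∀ i, p.2 i ∈ ball (0:ℂ) 1)} with hVdef
    have hV : IsOpen V := by
      refine IsOpen.inter (IsOpen.inter (isOpen_ball.preimage continuous_fst)
        (isOpen_ne.preimage continuous_fst)) (IsOpen.inter ?_ (hopen.preimage continuous_snd))
      exact isOpen_ne.preimage (by fun_prop :
        Continuous fun p : ℂ × (Fin (k + 1) → ℂ) => p.1 - p.2 0)
    have hH : DifferentiableOn ℂ (fun p : ℂ × (Fin (k + 1) → ℂ) =>
        (p.1 - p.2 0)⁻¹ • g (Fin.cons p.1 (Fin.tail p.2))) V := by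
      refine DifferentiableOn.fun_smul ?_ ?_
      · refine DifferentiableOn.inv (by fun_prop) fun p hp => hp.2.1
      · refine hg.comp (t := {z : Fin (k + 1) → ℂ | (∀ i, z i ∈ ball (0 : ℂ) 1) ∧ z 0 ≠ 0}) ?_ ?_
        · refine differentiableOn_pi.2 fun i => ?_
          refine Fin.cases ?_ (fun j => ?_) i
          · simpa using differentiableOn_fst
          · simp only [Fin.cons_succ, Fin.tail]
            fun_prop
        · intro p hp
          exact ⟨hcons _ (fun i => hp.2.2 i.succ) _ hp.1.1, by simpa using hp.1.2⟩
    have hD := aux_param hV hH (ρ := 1/2) (by norm_num) (x₀ := z) (by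
      intro s hs
      have hs' : ‖s‖ = 1/2 := by simpa using hs
      have hs0 : s ≠ 0 := by
        rintro rfl
        norm_num at hs'
      refine ⟨⟨?_, hs0⟩, ?_, hz⟩
      · rw [mem_ball_zero_iff, hs']; norm_num
      · simpa [hz0] using hs0)
    refine (hD.const_smul ((2 * π * Complex.I : ℂ)⁻¹)).congr_of_eventuallyEq ?_
    have hn : {x : Fin (k + 1) → ℂ | x 0 ∈ ball (0:ℂ) (1/2)} ∈ 𝓝 z :=
      (isOpen_ball.preimage (continuous_apply 0)).mem_nhds (by simp [hz0])
    filter_upwards [hn, hopen.mem_nhds hz] with x hx1 hx2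
    have hc : DiffContOnCl ℂ (S (Fin.tail x)) (ball 0 (1/2)) :=
      (hSd (Fin.tail x) (fun i => hx2 i.succ)).diffContOnCl_ball
        (closedBall_subset_ball (by norm_num))
    rw [← hc.two_pi_i_inv_smul_circleIntegral_sub_inv_smul hx1]
    simp only [Pi.smul_apply]
    congr 1
    refine circleIntegral.integral_congr (by norm_num) fun s hs => ?_
    have hs' : ‖s‖ = 1/2 := by simpa using hs
    have hs0 : s ≠ 0 := by
      rintro rfl
      norm_num at hs'
    simp [hS, Function.update_of_ne hs0]
  · refine (hg.differentiableAt (hopen'.mem_nhds ⟨hz, hz0⟩)).congr_of_eventuallyEq ?_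
    filter_upwards [hopen'.mem_nhds ⟨hz, hz0⟩] with x hx
    exact hSg x hx.2
end

section
/- Every holomorphic line bundle on Δ* × Δ^k is holomorphically trivial, where Δ is the unit disk and Δ* the punctured unit disk. -/
open Metric Set

namespace PPD
open Filter Topology MeasureTheory

theorem holo_integral {n : ℕ} {α : Type*} [MeasurableSpace α] {μ : Measure α}
    {V : Set (Fin n → ℂ)} (hV : IsOpen V) {F : α → (Fin n → ℂ) → ℂ} {bound : α → ℝ}
    (hF : ∀ᵐ a ∂μ, DifferentiableOn ℂ (F a) V)
    (hmeas : ∀ x ∈ V, AEStronglyMeasurable (fun a => F a x) μ)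
    (hb : ∀ᵐ a ∂μ, ∀ x ∈ V, ‖F a x‖ ≤ bound a) (hbi : Integrable bound μ) :
    DifferentiableOn ℂ (fun x => ∫ a, F a x ∂μ) V := by
  intro x₀ hx₀
  obtain ⟨ρ, hρ, hball⟩ := Metric.isOpen_iff.1 hV x₀ hx₀
  have hdiff : ∀ᵐ a ∂μ, HasFDerivAt (F a) (fderiv ℂ (F a) x₀) x₀ := by
    filter_upwards [hF] with a ha
    exact (ha.differentiableAt (hV.mem_nhds hx₀)).hasFDerivAt
  have hintg : Integrable (fun a => F a x₀) μ :=
    hbi.mono' (hmeas x₀ hx₀) (by filter_upwards [hb] with a ha using ha x₀ hx₀)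
  have hscal : ∀ i : Fin n, AEStronglyMeasurable
      (fun a => fderiv ℂ (F a) x₀ (Pi.single i 1)) μ := by
    intro i
    have hpos : ∀ m : ℕ, 0 < ((m : ℝ) + 2) / ρ := fun m => by positivity
    refine aestronglyMeasurable_of_tendsto_ae atTop
      (f := fun (m : ℕ) a => (((((m : ℝ) + 2) / ρ : ℝ) : ℂ)) •
        (F a (x₀ + (((((m : ℝ) + 2) / ρ : ℝ) : ℂ))⁻¹ • Pi.single i 1) - F a x₀)) ?_ ?_
    · intro m
      refine ((hmeas _ (hball ?_)).sub (hmeas x₀ hx₀)).const_smul (((((m : ℝ) + 2) / ρ : ℝ) : ℂ))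
      rw [mem_ball, dist_eq_norm, add_sub_cancel_left, norm_smul, norm_inv, Complex.norm_real,
        Real.norm_of_nonneg (hpos m).le, Pi.norm_single, norm_one, mul_one, inv_div,
        div_lt_iff₀ (by positivity)]
      nlinarith [(Nat.cast_nonneg m : (0:ℝ) ≤ m)]
    · filter_upwards [hdiff] with a ha
      refine ha.lim _ ?_
      have : Tendsto (fun m : ℕ => ((m : ℝ) + 2) / ρ) atTop atTop :=
        (tendsto_natCast_atTop_atTop.atTop_add tendsto_const_nhds).atTop_div_const hρ
      refine this.congr' ?_
      filter_upwards with m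
      rw [Complex.norm_real, Real.norm_of_nonneg (hpos m).le]
  have hfd : AEStronglyMeasurable (fun a => fderiv ℂ (F a) x₀) μ := by
    have : (fun a => fderiv ℂ (F a) x₀) = fun a => ∑ i : Fin n,
        (fderiv ℂ (F a) x₀ (Pi.single i 1)) •
          (ContinuousLinearMap.proj i : (Fin n → ℂ) →L[ℂ] ℂ) := by
      funext a
      ext v
      conv_lhs => rw [← Finset.univ_sum_single v, map_sum]
      simp only [sum_apply, smul_apply,
        ContinuousLinearMap.proj_apply, smul_eq_mul]
      refine Finset.sum_congr rfl fun i _ => ?_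
      have : (Pi.single i (v i) : Fin n → ℂ) = v i • Pi.single i 1 := by
        rw [← Pi.single_smul]; simp
      rw [this, map_smul, smul_eq_mul, mul_comm]
    rw [this]
    exact Finset.aestronglyMeasurable_fun_sum _ fun i _ => (hscal i).smul_const _
  have key := hasFDerivAt_integral_of_dominated_loc_of_lip' (𝕜 := ℂ) (F := fun x a => F a x)
    (F' := fun a => fderiv ℂ (F a) x₀) (bound := fun a => 2 * bound a / ρ) (x₀ := x₀) (μ := μ)
    (ball_mem_nhds x₀ hρ) (fun x hx => hmeas x (hball hx)) hintg hfd ?_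
    ((hbi.const_mul 2).div_const ρ) hdiff
  · exact key.2.differentiableAt.differentiableWithinAt
  · filter_upwards [hF, hb] with a ha hba x hx
    have := Complex.dist_le_div_mul_dist_of_mapsTo_ball (R₂ := 2 * bound a)
      (ha.mono hball) (fun y hy => ?_) hx
    · simpa [dist_eq_norm] using this
    · rw [mem_closedBall, dist_eq_norm]
      refine (norm_sub_le _ _).trans ?_
      linarith [hba y (hball hy), hba x₀ hx₀]

theorem holo_of_exp {E : Type*} [NormedAddCommGroup E] [NormedSpace ℂ E] {V : Set E}
    (hV : IsOpen V) {f h : E → ℂ} (hf : DifferentiableOn ℂ f V) (hh : ContinuousOn h V)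
    (he : ∀ z ∈ V, Complex.exp (h z) = f z) : DifferentiableOn ℂ h V := by
  intro x hx
  have hc : ContinuousAt h x := hh.continuousAt (hV.mem_nhds hx)
  have h1 : ∀ᶠ z in 𝓝 x, dist (h z) (h x) < 1 := hc (ball_mem_nhds (h x) one_pos)
  have heq : h =ᶠ[𝓝 x] fun z => h x + Complex.log (f z / f x) := by
    filter_upwards [h1, hV.mem_nhds hx] with z hz hzV
    rw [← he z hzV, ← he x hx, ← Complex.exp_sub, Complex.log_exp]
    · ring
    · have := (abs_le.1 (Complex.abs_im_le_norm (h z - h x))).1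
      rw [dist_eq_norm] at hz
      linarith [Real.pi_gt_three]
    · have := (abs_le.1 (Complex.abs_im_le_norm (h z - h x))).2
      rw [dist_eq_norm] at hz
      linarith [Real.pi_gt_three]
  have hfx : f x ≠ 0 := by rw [← he x hx]; exact Complex.exp_ne_zero _
  have hd : DifferentiableAt ℂ f x := hf.differentiableAt (hV.mem_nhds hx)
  refine (DifferentiableAt.congr_of_eventuallyEq ?_ heq).differentiableWithinAt
  have hd2 : DifferentiableAt ℂ (fun z => f z / f x) x := by
    simp only [div_eq_mul_inv]; exact hd.mul_const _
  refine (differentiableAt_const _).add (hd2.clog ?_)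
  rw [div_self hfx]; exact Complex.one_mem_slitPlane

theorem exists_log {E : Type*} [NormedAddCommGroup E] [NormedSpace ℂ E] {V : Set E}
    (hV : IsOpen V) (hc : Convex ℝ V) {f : E → ℂ} (hf : DifferentiableOn ℂ f V)
    (h0 : ∀ z ∈ V, f z ≠ 0) :
    ∃ h : E → ℂ, DifferentiableOn ℂ h V ∧ ∀ z ∈ V, f z = Complex.exp (h z) := by
  rcases V.eq_empty_or_nonempty with rfl | hne
  · exact ⟨0, by simp, by simp⟩
  have := hc.contractibleSpace hne
  have hsc : IsSimplyConnected V := (inferInstance : SimplyConnectedSpace V)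
  obtain ⟨h, hh, he⟩ := Complex.exists_continuousOn_eqOn_exp_comp hsc hV
    hf.continuousOn (by rintro ⟨z, hz, hz0⟩; exact h0 z hz hz0)
  exact ⟨h, holo_of_exp hV hf hh he, fun z hz => (he hz).symm⟩
end PPD

namespace PPD
open Filter Topology MeasureTheory

theorem holo_interval {n : ℕ} {A : Set (Fin n → ℂ)} (hA : IsOpen A) {s t : ℝ} (hst : s ≤ t)
    {G : ℝ → (Fin n → ℂ) → ℂ}
    (hc : ContinuousOn (fun p : ℝ × (Fin n → ℂ) => G p.1 p.2) (Icc s t ×ˢ A))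
    (hd : ∀ x ∈ Icc s t, DifferentiableOn ℂ (G x) A) :
    DifferentiableOn ℂ (fun z => ∫ x in s..t, G x z) A := by
  intro z₀ hz₀
  obtain ⟨ρ, hρ, hball⟩ := Metric.nhds_basis_closedBall.mem_iff.1 (hA.mem_nhds hz₀)
  have hK : IsCompact (Icc s t ×ˢ closedBall z₀ ρ) := isCompact_Icc.prod (isCompact_closedBall _ _)
  obtain ⟨M, hM⟩ := hK.exists_bound_of_continuousOn (hc.mono (prod_mono_right hball))
  have hb := ball_subset_closedBall (x := z₀) (ε := ρ)
  have key : DifferentiableOn ℂ (fun z => ∫ x, G x z ∂(volume.restrict (Ioc s t)))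
      (ball z₀ ρ) := by
    refine holo_integral (bound := fun _ => M) isOpen_ball ?_ ?_ ?_ ?_
    · refine (ae_restrict_iff' measurableSet_Ioc).2 (Eventually.of_forall fun x hx => ?_)
      exact (hd x (Ioc_subset_Icc_self hx)).mono (hb.trans hball)
    · intro z hz
      refine ContinuousOn.aestronglyMeasurable ?_ measurableSet_Ioc
      refine ContinuousOn.mono ?_ Ioc_subset_Icc_self
      exact hc.comp (f := fun x : ℝ => (x, z)) (by fun_prop)
        (fun x hx => ⟨hx, hball (hb hz)⟩)
    · refine (ae_restrict_iff' measurableSet_Ioc).2 (Eventually.of_forall fun x hx z hz => ?_)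
      exact hM (x, z) ⟨Ioc_subset_Icc_self hx, hb hz⟩
    · exact integrable_const M
  have := (key.differentiableAt (isOpen_ball.mem_nhds (mem_ball_self hρ)))
  simp only [intervalIntegral.integral_of_le hst]
  exact this.differentiableWithinAt

/-- boundary integral over a rectangle -/
noncomputable def bd (x₁ x₂ y₁ y₂ : ℝ) (f : ℂ → ℂ) : ℂ :=
  (∫ x : ℝ in x₁..x₂, f (x + y₁ * Complex.I)) - (∫ x : ℝ in x₁..x₂, f (x + y₂ * Complex.I)) +
      Complex.I * (∫ y : ℝ in y₁..y₂, f (x₂ + y * Complex.I)) -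
      Complex.I * (∫ y : ℝ in y₁..y₂, f (x₁ + y * Complex.I))

theorem bd_zero {x₁ x₂ y₁ y₂ : ℝ} (hx : x₁ ≤ x₂) (hy : y₁ ≤ y₂) {f : ℂ → ℂ}
    (hf : DifferentiableOn ℂ f (Icc x₁ x₂ ×ℂ Icc y₁ y₂)) : bd x₁ x₂ y₁ y₂ f = 0 := by
  have := Complex.integral_boundary_rect_eq_zero_of_differentiableOn f ⟨x₁, y₁⟩ ⟨x₂, y₂⟩
    (by simpa [uIcc_of_le hx, uIcc_of_le hy] using hf)
  simpa [bd] using this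

theorem log_I_mul {z : ℂ} (hz : 0 < z.re) :
    Complex.log (Complex.I * z) = Complex.log z + Real.pi / 2 * Complex.I := by
  have h0 : z ≠ 0 := by rintro rfl; simp at hz
  have h1 := abs_lt.1 (Complex.abs_arg_lt_pi_div_two_iff.2 (Or.inl hz))
  rw [(Complex.log_mul_eq_add_log_iff Complex.I_ne_zero h0).2, Complex.log_I, add_comm]
  rw [Complex.arg_I]
  constructor <;> linarith [Real.pi_pos]

theorem log_neg_I_mul {z : ℂ} (hz : 0 < z.re) :
    Complex.log (-Complex.I * z) = Complex.log z - Real.pi / 2 * Complex.I := by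
  have h0 : z ≠ 0 := by rintro rfl; simp at hz
  have h1 := abs_lt.1 (Complex.abs_arg_lt_pi_div_two_iff.2 (Or.inl hz))
  rw [(Complex.log_mul_eq_add_log_iff (by simp) h0).2, Complex.log_neg_I]
  · ring
  rw [Complex.arg_neg_I]
  constructor <;> linarith [Real.pi_pos]

theorem int_log {s t : ℝ} {c d k : ℂ} (hk : k ≠ 0) (hd : d ≠ 0)
    (h : ∀ x : ℝ, 0 < (k * (c + x * d)).re) :
    d * (∫ x : ℝ in s..t, (c + x * d)⁻¹) =
      Complex.log (k * (c + t * d)) - Complex.log (k * (c + s * d)) := by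
  have hne : ∀ x : ℝ, c + x * d ≠ 0 := by
    intro x hx; have := h x; rw [hx] at this; simp at this
  rw [← intervalIntegral.integral_const_mul]
  refine intervalIntegral.integral_eq_sub_of_hasDerivAt
    (f := fun x : ℝ => Complex.log (k * (c + x * d))) ?_ ?_
  · intro x _
    have h1 : HasDerivAt (fun x : ℝ => k * (c + x * d)) (k * d) x := by
      have := ((Complex.ofRealCLM.hasDerivAt (x := x)).mul_const d).const_add c |>.const_mul k
      simpa using this
    have := h1.clog_real (Or.inl (h x))
    rw [mul_div_mul_left _ _ hk, div_eq_mul_inv] at this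
    exact this
  · refine ContinuousOn.intervalIntegrable ?_
    exact Continuous.continuousOn (continuous_const.mul
      (Continuous.inv₀ (by fun_prop) hne))

theorem bd_inv {x₁ x₂ y₁ y₂ : ℝ} {w : ℂ} (hw : w ∈ Ioo x₁ x₂ ×ℂ Ioo y₁ y₂) :
    bd x₁ x₂ y₁ y₂ (fun ζ => (ζ - w)⁻¹) = 2 * Real.pi * Complex.I := by
  obtain ⟨⟨h1, h2⟩, h3, h4⟩ := hw
  have b := int_log (s := x₁) (t := x₂) (c := y₁ * Complex.I - w) (d := 1) (k := Complex.I)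
    (by simp) (by simp) (by intro x; simp; linarith)
  have t := int_log (s := x₁) (t := x₂) (c := y₂ * Complex.I - w) (d := 1) (k := -Complex.I)
    (by simp) (by simp) (by intro x; simp; linarith)
  have r := int_log (s := y₁) (t := y₂) (c := x₂ - w) (d := Complex.I) (k := 1)
    (by simp) (by simp) (by intro x; simp; linarith)
  have l := int_log (s := y₁) (t := y₂) (c := x₁ - w) (d := Complex.I) (k := -1)
    (by simp) (by simp) (by intro x; simp; linarith)
  have e1 : ∀ (y : ℝ) (x : ℝ), (y * Complex.I - w) + x * 1 = x + y * Complex.I - w := by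
    intros; ring
  have e2 : ∀ (y : ℝ) (x : ℝ), ((x : ℂ) - w) + y * Complex.I = x + y * Complex.I - w := by
    intros; ring
  simp only [e1, e2, one_mul] at b t r l
  unfold bd
  rw [b, t, r, l]
  have q1 : Complex.log (Complex.I * (x₂ + y₁ * Complex.I - w)) = _ :=
    log_I_mul (z := x₂ + y₁ * Complex.I - w) (by simp; linarith)
  have q2 : Complex.log (-Complex.I * (x₂ + y₂ * Complex.I - w)) = _ :=
    log_neg_I_mul (z := x₂ + y₂ * Complex.I - w) (by simp; linarith)
  have q3 := log_I_mul (z := -1 * (x₁ + y₂ * Complex.I - w)) (by simp; linarith)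
  have q4 := log_neg_I_mul (z := -1 * (x₁ + y₁ * Complex.I - w)) (by simp; linarith)
  have q3' : Complex.I * (-1 * (x₁ + y₂ * Complex.I - w)) =
    -Complex.I * (x₁ + y₂ * Complex.I - w) := by ring
  have q4' : -Complex.I * (-1 * (x₁ + y₁ * Complex.I - w)) =
    Complex.I * (x₁ + y₁ * Complex.I - w) := by ring
  rw [q3'] at q3
  rw [q4'] at q4
  rw [q1, q2, q3, q4]
  ring

theorem bd_cauchy {x₁ x₂ y₁ y₂ : ℝ} {w : ℂ} (hw : w ∈ Ioo x₁ x₂ ×ℂ Ioo y₁ y₂) {U : Set ℂ}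
    (hU : IsOpen U) (hsub : Icc x₁ x₂ ×ℂ Icc y₁ y₂ ⊆ U) {f : ℂ → ℂ} (hf : DifferentiableOn ℂ f U) :
    bd x₁ x₂ y₁ y₂ (fun ζ => f ζ * (ζ - w)⁻¹) = 2 * Real.pi * Complex.I * f w := by
  have hw' := hw
  obtain ⟨⟨h1, h2⟩, h3, h4⟩ := hw
  have hx := (h1.trans h2).le
  have hy := (h3.trans h4).le
  have hwU : w ∈ U := hsub ⟨⟨h1.le, h2.le⟩, h3.le, h4.le⟩
  have hds : DifferentiableOn ℂ (dslope f w) U :=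
    (Complex.differentiableOn_dslope (hU.mem_nhds hwU)).2 hf
  have hz := bd_zero hx hy (hds.mono hsub)
  have hi := bd_inv hw'
  have side : ∀ (γ : ℝ → ℂ) (s t : ℝ), s ≤ t → Continuous γ →
      (∀ x ∈ Icc s t, γ x ∈ Icc x₁ x₂ ×ℂ Icc y₁ y₂ ∧ γ x ≠ w) →
      (∫ x in s..t, f (γ x) * (γ x - w)⁻¹) =
        (∫ x in s..t, dslope f w (γ x)) + (∫ x in s..t, (γ x - w)⁻¹) * f w := by
    intro γ s t hst hγ hγ2
    rw [← intervalIntegral.integral_mul_const, ← intervalIntegral.integral_add]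
    · refine intervalIntegral.integral_congr fun x hx => ?_
      rw [uIcc_of_le hst] at hx
      have := sub_ne_zero.2 (hγ2 x hx).2
      rw [dslope_of_ne _ (hγ2 x hx).2, slope_def_field]
      field_simp
      ring
    · refine ContinuousOn.intervalIntegrable ?_
      rw [uIcc_of_le hst]
      exact hds.continuousOn.comp hγ.continuousOn fun x hx => hsub (hγ2 x hx).1
    · refine ContinuousOn.intervalIntegrable ?_
      rw [uIcc_of_le hst]
      refine ContinuousOn.mul (ContinuousOn.inv₀ (by fun_prop) ?_) continuousOn_const
      exact fun x hx => sub_ne_zero.2 (hγ2 x hx).2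
  have s1 := side (fun x => x + y₁ * Complex.I) x₁ x₂ hx (by fun_prop) (by
    intro x hx
    refine ⟨⟨by simpa using hx, by simp [hy]⟩, fun h => ?_⟩
    have := congrArg Complex.im h; simp at this; linarith)
  have s2 := side (fun x => x + y₂ * Complex.I) x₁ x₂ hx (by fun_prop) (by
    intro x hx
    refine ⟨⟨by simpa using hx, by simp [hy]⟩, fun h => ?_⟩
    have := congrArg Complex.im h; simp at this; linarith)
  have s3 := side (fun y => x₂ + y * Complex.I) y₁ y₂ hy (by fun_prop) (by
    intro x hx
    refine ⟨⟨by simpa using ‹x₁ ≤ x₂›, by simpa using hx⟩, fun h => ?_⟩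
    have := congrArg Complex.re h; simp at this; linarith)
  have s4 := side (fun y => x₁ + y * Complex.I) y₁ y₂ hy (by fun_prop) (by
    intro x hx
    refine ⟨⟨by simpa using ‹x₁ ≤ x₂›, by simpa using hx⟩, fun h => ?_⟩
    have := congrArg Complex.re h; simp at this; linarith)
  unfold bd at hz hi ⊢
  rw [s1, s2, s3, s4]
  linear_combination hz + f w * hi
end PPD

namespace PPD
open Filter Topology MeasureTheory

theorem side_cont {n : ℕ} {ℓ : (Fin n → ℂ) →L[ℂ] ℂ} {e : Fin n → ℂ} (he : ℓ e = 1)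
    {O : Set (Fin n → ℂ)} (hOe : ∀ z ∈ O, ∀ c : ℂ, z + c • e ∈ O)
    {U : Set ℂ} {h : (Fin n → ℂ) → ℂ} (hh : DifferentiableOn ℂ h (O ∩ ℓ ⁻¹' U))
    {γ : ℝ → ℂ} (hγ : Continuous γ) {s t : ℝ} (hγU : ∀ x ∈ Icc s t, γ x ∈ U)
    {A : Set (Fin n → ℂ)} (hAO : A ⊆ O) (hne : ∀ z ∈ A, ∀ x ∈ Icc s t, γ x ≠ ℓ z) :
    ContinuousOn (fun p : ℝ × (Fin n → ℂ) => h (p.2 + (γ p.1 - ℓ p.2) • e) * (γ p.1 - ℓ p.2)⁻¹)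
      (Icc s t ×ˢ A) := by
  refine ContinuousOn.mul (hh.continuousOn.comp (by fun_prop) ?_) (ContinuousOn.inv₀ (by fun_prop) ?_)
  · rintro ⟨x, z⟩ ⟨hx, hz⟩
    refine ⟨hOe z (hAO hz) _, ?_⟩
    simpa [he] using hγU x hx
  · rintro ⟨x, z⟩ ⟨hx, hz⟩
    exact sub_ne_zero.2 (hne z hz x hx)

theorem side_holo {n : ℕ} {ℓ : (Fin n → ℂ) →L[ℂ] ℂ} {e : Fin n → ℂ} (he : ℓ e = 1)
    {O : Set (Fin n → ℂ)} (hOe : ∀ z ∈ O, ∀ c : ℂ, z + c • e ∈ O)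
    {U : Set ℂ} {h : (Fin n → ℂ) → ℂ} (hh : DifferentiableOn ℂ h (O ∩ ℓ ⁻¹' U))
    {γ : ℝ → ℂ} (hγ : Continuous γ) {s t : ℝ} (hst : s ≤ t) (hγU : ∀ x ∈ Icc s t, γ x ∈ U)
    {A : Set (Fin n → ℂ)} (hA : IsOpen A) (hAO : A ⊆ O)
    (hne : ∀ z ∈ A, ∀ x ∈ Icc s t, γ x ≠ ℓ z) :
    DifferentiableOn ℂ (fun z => ∫ x in s..t, h (z + (γ x - ℓ z) • e) * (γ x - ℓ z)⁻¹) A := by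
  refine holo_interval hA hst (side_cont he hOe hh hγ hγU hAO hne) ?_
  intro x hx
  refine DifferentiableOn.mul (hh.comp (by fun_prop) ?_) (DifferentiableOn.inv (by fun_prop) ?_)
  · intro z hz
    refine ⟨hOe z (hAO hz) _, ?_⟩
    simpa [he] using hγU x hx
  · intro z hz
    exact sub_ne_zero.2 (hne z hz x hx)

/-- boundary of a rectangle -/
def rbd (x₁ x₂ y₁ y₂ : ℝ) : Set ℂ := (Icc x₁ x₂ ×ℂ Icc y₁ y₂) \ (Ioo x₁ x₂ ×ℂ Ioo y₁ y₂)

theorem isClosed_rbd {x₁ x₂ y₁ y₂ : ℝ} : IsClosed (rbd x₁ x₂ y₁ y₂) :=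
  (isClosed_Icc.reProdIm isClosed_Icc).sdiff (isOpen_Ioo.reProdIm isOpen_Ioo)

theorem add_split {n : ℕ} {ℓ : (Fin n → ℂ) →L[ℂ] ℂ} {e : Fin n → ℂ} (he : ℓ e = 1)
    {O : Set (Fin n → ℂ)} (hO : IsOpen O) (hOe : ∀ z ∈ O, ∀ c : ℂ, z + c • e ∈ O)
    {U : Set ℂ} (hU : IsOpen U) {x₁ v x₂ y₁ y₂ : ℝ} (h1 : x₁ < v) (h2 : v < x₂) (h3 : y₁ < y₂)
    (hsub : Icc x₁ x₂ ×ℂ Icc y₁ y₂ ⊆ U)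
    {h : (Fin n → ℂ) → ℂ} (hh : DifferentiableOn ℂ h (O ∩ ℓ ⁻¹' U)) :
    ∃ a b : (Fin n → ℂ) → ℂ,
      DifferentiableOn ℂ a {z | z ∈ O ∧ ¬ (ℓ z ∈ rbd x₁ x₂ y₁ y₂ ∧ v ≤ (ℓ z).re)} ∧
      DifferentiableOn ℂ b {z | z ∈ O ∧ ¬ (ℓ z ∈ rbd x₁ x₂ y₁ y₂ ∧ (ℓ z).re ≤ v)} ∧
      (∀ z ∈ O, ℓ z ∈ Ioo x₁ x₂ ×ℂ Ioo y₁ y₂ → a z - b z = h z) ∧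
      (∀ z ∈ O, ℓ z ∉ Icc x₁ x₂ ×ℂ Icc y₁ y₂ → a z = b z) := by
  have hop1 : IsOpen {z | z ∈ O ∧ ¬ (ℓ z ∈ rbd x₁ x₂ y₁ y₂ ∧ v ≤ (ℓ z).re)} := by
    refine hO.inter (isOpen_compl_iff.2 ?_)
    exact (isClosed_rbd.preimage ℓ.continuous).inter
      (isClosed_le continuous_const (Complex.continuous_re.comp ℓ.continuous))
  have hop2 : IsOpen {z | z ∈ O ∧ ¬ (ℓ z ∈ rbd x₁ x₂ y₁ y₂ ∧ (ℓ z).re ≤ v)} := by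
    refine hO.inter (isOpen_compl_iff.2 ?_)
    exact (isClosed_rbd.preimage ℓ.continuous).inter
      (isClosed_le (Complex.continuous_re.comp ℓ.continuous) continuous_const)
  -- membership of the sides
  have mb : ∀ x ∈ Icc x₁ x₂, ((x : ℂ) + y₁ * Complex.I) ∈ rbd x₁ x₂ y₁ y₂ := by
    intro x hx; exact ⟨⟨by simpa using hx, by simp [h3.le]⟩, fun h => by simpa using h.2.1⟩
  have mt : ∀ x ∈ Icc x₁ x₂, ((x : ℂ) + y₂ * Complex.I) ∈ rbd x₁ x₂ y₁ y₂ := by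
    intro x hx; exact ⟨⟨by simpa using hx, by simp [h3.le]⟩, fun h => by simpa using h.2.2⟩
  have mr : ∀ y ∈ Icc y₁ y₂, ((x₂ : ℂ) + y * Complex.I) ∈ rbd x₁ x₂ y₁ y₂ := by
    intro x hx
    exact ⟨⟨by simpa using (h1.trans h2).le, by simpa using hx⟩, fun h => by simpa using h.1.2⟩
  have ml : ∀ y ∈ Icc y₁ y₂, ((x₁ : ℂ) + y * Complex.I) ∈ rbd x₁ x₂ y₁ y₂ := by
    intro x hx
    exact ⟨⟨by simpa using (h1.trans h2).le, by simpa using hx⟩, fun h => by simpa using h.1.1⟩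
  have s1 : Icc x₁ v ⊆ Icc x₁ x₂ := Icc_subset_Icc_right h2.le
  have s2 : Icc v x₂ ⊆ Icc x₁ x₂ := Icc_subset_Icc_left h1.le
  let F : (Fin n → ℂ) → ℂ → ℂ := fun z ζ => h (z + (ζ - ℓ z) • e) * (ζ - ℓ z)⁻¹
  have c0 : (2 * Real.pi * Complex.I : ℂ) ≠ 0 := by simp [Real.pi_ne_zero]
  have hbd : ∀ z ∈ O, ℓ z ∉ rbd x₁ x₂ y₁ y₂ →
      ((∫ x : ℝ in v..x₂, F z (x + y₁ * Complex.I)) - (∫ x : ℝ in v..x₂, F z (x + y₂ * Complex.I)) +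
      Complex.I * (∫ y : ℝ in y₁..y₂, F z (x₂ + y * Complex.I))) +
      ((∫ x : ℝ in x₁..v, F z (x + y₁ * Complex.I)) - (∫ x : ℝ in x₁..v, F z (x + y₂ * Complex.I)) -
      Complex.I * (∫ y : ℝ in y₁..y₂, F z (x₁ + y * Complex.I))) = bd x₁ x₂ y₁ y₂ (F z) := by
    intro z hz hzr
    have key : ∀ y : ℝ, (∀ x ∈ Icc x₁ x₂, ((x : ℂ) + y * Complex.I) ∈ rbd x₁ x₂ y₁ y₂) →
        (∫ x : ℝ in x₁..v, F z (x + y * Complex.I)) + (∫ x : ℝ in v..x₂, F z (x + y * Complex.I))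
        = ∫ x : ℝ in x₁..x₂, F z (x + y * Complex.I) := by
      intro y hy
      have hcont : ContinuousOn (fun x : ℝ => F z (x + y * Complex.I)) (Icc x₁ x₂) := by
        have := side_cont he hOe hh (γ := fun x => x + y * Complex.I) (by fun_prop)
          (s := x₁) (t := x₂) (A := {z}) (fun x hx => hsub (hy x hx).1) (by simpa using hz)
          (by rintro z' rfl x hx h; exact hzr (h ▸ hy x hx))
        exact this.comp (f := fun x : ℝ => (x, z)) (by fun_prop) (fun x hx => ⟨hx, rfl⟩)
      refine intervalIntegral.integral_add_adjacent_intervals ?_ ?_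
      · exact ContinuousOn.intervalIntegrable (by rw [uIcc_of_le h1.le]; exact hcont.mono s1)
      · exact ContinuousOn.intervalIntegrable (by rw [uIcc_of_le h2.le]; exact hcont.mono s2)
    unfold bd
    rw [← key y₁ mb, ← key y₂ mt]
    ring
  have hline : ∀ z ∈ O, DifferentiableOn ℂ (fun ζ : ℂ => h (z + (ζ - ℓ z) • e)) U := by
    intro z hz
    refine hh.comp (by fun_prop) ?_
    intro ζ hζ
    exact ⟨hOe z hz _, by simpa [he] using hζ⟩
  refine ⟨fun z => (2 * Real.pi * Complex.I)⁻¹ *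
    ((∫ x : ℝ in v..x₂, F z (x + y₁ * Complex.I)) - (∫ x : ℝ in v..x₂, F z (x + y₂ * Complex.I)) +
      Complex.I * (∫ y : ℝ in y₁..y₂, F z (x₂ + y * Complex.I))),
    fun z => -((2 * Real.pi * Complex.I)⁻¹ *
    ((∫ x : ℝ in x₁..v, F z (x + y₁ * Complex.I)) - (∫ x : ℝ in x₁..v, F z (x + y₂ * Complex.I)) -
      Complex.I * (∫ y : ℝ in y₁..y₂, F z (x₁ + y * Complex.I)))), ?_, ?_, ?_, ?_⟩
  · refine DifferentiableOn.const_mul (((?_ : DifferentiableOn ℂ _ _).sub ?_).add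
      (DifferentiableOn.const_mul ?_ _)) _
    · refine side_holo he hOe hh (γ := fun x => x + y₁ * Complex.I) (by fun_prop) h2.le
        (fun x hx => hsub (mb x (s2 hx)).1) hop1 (fun z hz => hz.1) ?_
      intro z hz x hx h
      refine hz.2 ⟨h ▸ mb x (s2 hx), ?_⟩
      rw [← h]; simpa using hx.1
    · refine side_holo he hOe hh (γ := fun x => x + y₂ * Complex.I) (by fun_prop) h2.le
        (fun x hx => hsub (mt x (s2 hx)).1) hop1 (fun z hz => hz.1) ?_
      intro z hz x hx h
      refine hz.2 ⟨h ▸ mt x (s2 hx), ?_⟩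
      rw [← h]; simpa using hx.1
    · refine side_holo he hOe hh (γ := fun y => x₂ + y * Complex.I) (by fun_prop) h3.le
        (fun x hx => hsub (mr x hx).1) hop1 (fun z hz => hz.1) ?_
      intro z hz x hx h
      refine hz.2 ⟨h ▸ mr x hx, ?_⟩
      rw [← h]; simpa using h2.le
  · refine DifferentiableOn.neg (DifferentiableOn.const_mul
      (((?_ : DifferentiableOn ℂ _ _).sub ?_).sub
      (DifferentiableOn.const_mul ?_ _)) _)
    · refine side_holo he hOe hh (γ := fun x => x + y₁ * Complex.I) (by fun_prop) h1.le
        (fun x hx => hsub (mb x (s1 hx)).1) hop2 (fun z hz => hz.1) ?_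
      intro z hz x hx h
      refine hz.2 ⟨h ▸ mb x (s1 hx), ?_⟩
      rw [← h]; simpa using hx.2
    · refine side_holo he hOe hh (γ := fun x => x + y₂ * Complex.I) (by fun_prop) h1.le
        (fun x hx => hsub (mt x (s1 hx)).1) hop2 (fun z hz => hz.1) ?_
      intro z hz x hx h
      refine hz.2 ⟨h ▸ mt x (s1 hx), ?_⟩
      rw [← h]; simpa using hx.2
    · refine side_holo he hOe hh (γ := fun y => x₁ + y * Complex.I) (by fun_prop) h3.le
        (fun x hx => hsub (ml x hx).1) hop2 (fun z hz => hz.1) ?_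
      intro z hz x hx h
      refine hz.2 ⟨h ▸ ml x hx, ?_⟩
      rw [← h]; simpa using h1.le
  · intro z hz hzi
    have := hbd z hz (fun h => h.2 hzi)
    have hc := bd_cauchy hzi hU hsub (hline z hz)
    simp only [sub_self, zero_smul, add_zero] at hc
    simp only
    rw [sub_neg_eq_add, ← mul_add, this, inv_mul_eq_iff_eq_mul₀ c0]
    exact hc
  · intro z hz hzi
    have := hbd z hz (fun h => hzi h.1)
    have hc : bd x₁ x₂ y₁ y₂ (F z) = 0 := by
      refine bd_zero (h1.trans h2).le h3.le ?_
      refine ((hline z hz).mono hsub).mul (DifferentiableOn.inv (by fun_prop) ?_)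
      rintro ζ hζ h
      exact hzi ((sub_eq_zero.1 h) ▸ hζ)
    rw [hc] at this
    simp only
    linear_combination (2 * Real.pi * Complex.I : ℂ)⁻¹ * this
end PPD

namespace PPD
open Filter Topology MeasureTheory

theorem mult_split1 {n : ℕ} {ℓ : (Fin n → ℂ) →L[ℂ] ℂ} {e : Fin n → ℂ} (he : ℓ e = 1)
    {O : Set (Fin n → ℂ)} (hO : IsOpen O) (hOc : Convex ℝ O)
    (hOe : ∀ z ∈ O, ∀ c : ℂ, z + c • e ∈ O)
    {C : Set ℂ} (hC : IsCompact C) (hCc : Convex ℝ C) {v : ℝ} (hCv : ∀ ζ ∈ C, ζ.re = v)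
    {δ : ℝ} (hδ : 0 < δ) {f : (Fin n → ℂ) → ℂ}
    (hf : DifferentiableOn ℂ f (O ∩ ℓ ⁻¹' (thickening δ C)))
    (hf0 : ∀ z ∈ O ∩ ℓ ⁻¹' (thickening δ C), f z ≠ 0) :
    ∃ (D Q : Set ℂ) (a b : (Fin n → ℂ) → ℂ), IsClosed D ∧ D ⊆ thickening δ C ∧ Disjoint D C ∧
      IsOpen Q ∧ C ⊆ Q ∧ Q ⊆ thickening δ C ∧
      DifferentiableOn ℂ a {z | z ∈ O ∧ ¬ (ℓ z ∈ D ∧ v ≤ (ℓ z).re)} ∧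
      DifferentiableOn ℂ b {z | z ∈ O ∧ ¬ (ℓ z ∈ D ∧ (ℓ z).re ≤ v)} ∧
      (∀ z, a z ≠ 0) ∧ (∀ z, b z ≠ 0) ∧
      (∀ z ∈ O, ℓ z ∈ Q → a z = f z * b z) ∧
      (∀ z ∈ O, ℓ z ∉ thickening δ C → a z = b z) := by
  rcases C.eq_empty_or_nonempty with rfl | hne
  · refine ⟨∅, ∅, fun _ => 1, fun _ => 1, by simp, by simp, by simp, by simp, by simp, by simp,
      by simp, by simp, by simp, by simp, by simp, by simp⟩
  obtain ⟨h, hh, hfh⟩ := exists_log (hO.inter (isOpen_thickening.preimage ℓ.continuous))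
    (hOc.inter ((hCc.thickening δ).linear_preimage (ℓ.toLinearMap.restrictScalars ℝ))) hf hf0
  obtain him : Complex.im '' C = Icc (sInf (Complex.im '' C)) (sSup (Complex.im '' C)) :=
    eq_Icc_of_connected_compact ((hCc.isConnected hne).image _ Complex.continuous_im.continuousOn)
      (hC.image Complex.continuous_im)
  generalize sInf (Complex.im '' C) = c at him
  generalize sSup (Complex.im '' C) = d at him
  have hcd : c ≤ d := by
    have : (Icc c d).Nonempty := him ▸ hne.image _
    simpa using this
  have hsub : Icc (v - δ / 3) (v + δ / 3) ×ℂ Icc (c - δ / 3) (d + δ / 3) ⊆ thickening δ C := by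
    rintro ζ ⟨⟨h1, h2⟩, h3, h4⟩
    obtain ⟨ξ, hξ, hξi⟩ : max c (min d ζ.im) ∈ Complex.im '' C := by
      rw [him]; exact ⟨le_max_left _ _, max_le hcd (min_le_left _ _)⟩
    refine mem_thickening_iff.2 ⟨ξ, hξ, ?_⟩
    rw [dist_eq_norm]
    refine (Complex.norm_le_abs_re_add_abs_im _).trans_lt ?_
    have e1 : |(ζ - ξ).re| ≤ δ / 3 := by
      rw [Complex.sub_re, hCv ξ hξ, abs_le]; constructor <;> linarith
    have e2 : |(ζ - ξ).im| ≤ δ / 3 := by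
      rw [Complex.sub_im, hξi, abs_le]
      rcases le_total d ζ.im with h | h
      · rw [min_eq_left h, max_eq_right hcd]; constructor <;> linarith
      · rw [min_eq_right h]
        rcases le_total c ζ.im with h' | h'
        · rw [max_eq_right h']; constructor <;> linarith
        · rw [max_eq_left h']; constructor <;> linarith
    linarith
  have hCQ : C ⊆ Ioo (v - δ / 3) (v + δ / 3) ×ℂ Ioo (c - δ / 3) (d + δ / 3) := by
    intro ζ hζ
    have h1 := hCv ζ hζ
    have h2 : ζ.im ∈ Icc c d := him ▸ mem_image_of_mem _ hζ
    refine ⟨?_, ?_⟩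
    · simp only [mem_preimage, mem_Ioo, h1]; constructor <;> linarith
    · simp only [mem_preimage, mem_Ioo]; constructor <;> linarith [h2.1, h2.2]
  obtain ⟨a, b, ha, hb, hab, hab'⟩ := add_split he hO hOe (isOpen_thickening (δ := δ) (E := C))
    (x₁ := v - δ / 3) (v := v) (x₂ := v + δ / 3) (y₁ := c - δ / 3) (y₂ := d + δ / 3)
    (by linarith) (by linarith) (by linarith) hsub hh
  refine ⟨rbd (v - δ / 3) (v + δ / 3) (c - δ / 3) (d + δ / 3),
    Ioo (v - δ / 3) (v + δ / 3) ×ℂ Ioo (c - δ / 3) (d + δ / 3),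
    fun z => Complex.exp (a z), fun z => Complex.exp (b z), isClosed_rbd,
    fun ζ hζ => hsub hζ.1, ?_, isOpen_Ioo.reProdIm isOpen_Ioo, hCQ, ?_, ha.cexp, hb.cexp,
    fun z => Complex.exp_ne_zero _, fun z => Complex.exp_ne_zero _, ?_, ?_⟩
  · rw [Set.disjoint_left]
    intro ζ hζ hζC
    exact hζ.2 (hCQ hζC)
  · intro ζ hζ
    exact hsub ⟨Ioo_subset_Icc_self hζ.1, Ioo_subset_Icc_self hζ.2⟩
  · intro z hz hzQ
    have hzT : ℓ z ∈ thickening δ C :=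
      hsub ⟨Ioo_subset_Icc_self hzQ.1, Ioo_subset_Icc_self hzQ.2⟩
    simp only
    rw [hfh z ⟨hz, hzT⟩, ← Complex.exp_add, ← hab z hz hzQ, sub_add_cancel]
  · intro z hz hzT
    simp only
    rw [hab' z hz (fun h => hzT (hsub h))]

/-- multiplicative splitting property of a pair of sets -/
def Split {n : ℕ} (A₀ B₀ : Set (Fin n → ℂ)) : Prop :=
  ∀ N : Set (Fin n → ℂ), IsOpen N → A₀ ∩ B₀ ⊆ N → ∀ f : (Fin n → ℂ) → ℂ,
    DifferentiableOn ℂ f N → (∀ z ∈ N, f z ≠ 0) →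
    ∃ (A B G : Set (Fin n → ℂ)) (a b : (Fin n → ℂ) → ℂ), IsOpen A ∧ IsOpen B ∧ IsOpen G ∧
      A₀ ⊆ A ∧ B₀ ⊆ B ∧ A₀ ∩ B₀ ⊆ G ∧ DifferentiableOn ℂ a A ∧ DifferentiableOn ℂ b B ∧
      (∀ z, a z ≠ 0) ∧ (∀ z, b z ≠ 0) ∧ ∀ z ∈ A ∩ B ∩ G, a z = f z * b z

theorem box_split {n : ℕ} {R : Fin n → Set ℂ} (hR : ∀ i, IsCompact (R i)) (j : Fin n)
    (hRc : ∀ i, i ≠ j → Convex ℝ (R i)) {u : ℂ} (hu : ‖u‖ = 1) (v : ℝ)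
    {C₁ C₂ : Set ℂ} (h1 : IsCompact C₁) (h2 : IsCompact C₂) (h1c : Convex ℝ C₁)
    (h2c : Convex ℝ C₂) (hdis : Disjoint C₁ C₂)
    (hC : {ζ : ℂ | ζ.re = v ∧ u⁻¹ * ζ ∈ R j} = C₁ ∪ C₂) :
    Split (pi univ R ∩ {z | (u * z j).re ≤ v}) (pi univ R ∩ {z | v ≤ (u * z j).re}) := by
  classical
  intro N hN hsub f hf hf0
  have hu0 : u ≠ 0 := by rintro rfl; simp at hu
  set ℓ : (Fin n → ℂ) →L[ℂ] ℂ := u • ContinuousLinearMap.proj j with hℓ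
  have hℓa : ∀ z, ℓ z = u * z j := fun z => by simp [hℓ]
  set e : Fin n → ℂ := Pi.single j u⁻¹ with he'
  have he : ℓ e = 1 := by rw [hℓa, he', Pi.single_eq_same, mul_inv_cancel₀ hu0]
  have hS : IsCompact (pi univ R ∩ {z : Fin n → ℂ | (u * z j).re = v}) :=
    (isCompact_univ_pi hR).inter_right (isClosed_eq (by fun_prop) continuous_const)
  have hSN : pi univ R ∩ {z : Fin n → ℂ | (u * z j).re = v} ⊆ N := fun z hz =>
    hsub ⟨⟨hz.1, le_of_eq hz.2⟩, hz.1, ge_of_eq hz.2⟩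
  obtain ⟨δ₁, hδ₁, hδN⟩ := hS.exists_thickening_subset_open hN hSN
  obtain ⟨δ₂, hδ₂, hδd⟩ := hdis.exists_thickenings h1 h2.isClosed
  set δ := min δ₁ δ₂ with hδe
  have hδ : 0 < δ := lt_min hδ₁ hδ₂
  have hTd : Disjoint (thickening δ C₁) (thickening δ C₂) :=
    hδd.mono (thickening_mono (min_le_right _ _) _) (thickening_mono (min_le_right _ _) _)
  have hT1 : C₁ ⊆ thickening δ C₁ := self_subset_thickening hδ _
  have hT2 : C₂ ⊆ thickening δ C₂ := self_subset_thickening hδ _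
  set O : Set (Fin n → ℂ) := ⋂ i ∈ {i | i ≠ j}, (fun z : Fin n → ℂ => z i) ⁻¹' (thickening δ (R i))
    with hOdef
  have hO : IsOpen O := (Set.toFinite {i | i ≠ j}).isOpen_biInter fun i _ =>
    isOpen_thickening.preimage (continuous_apply i)
  have hOm : ∀ z, z ∈ O ↔ ∀ i, i ≠ j → z i ∈ thickening δ (R i) := by
    intro z; simp [hOdef]
  have hOc : Convex ℝ O := convex_iInter₂ fun i hi =>
    ((hRc i hi).thickening δ).linear_preimage (LinearMap.proj (R := ℝ) (φ := fun _ : Fin n => ℂ) i)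
  have hOe : ∀ z ∈ O, ∀ c : ℂ, z + c • e ∈ O := by
    intro z hz c
    rw [hOm] at hz ⊢
    intro i hi
    simpa [he', Pi.single_eq_of_ne hi] using hz i hi
  have hSO : pi univ R ⊆ O := by
    intro z hz
    rw [hOm]
    exact fun i _ => self_subset_thickening hδ _ (hz i (mem_univ i))
  have hNm : ∀ C : Set ℂ, C ⊆ C₁ ∪ C₂ → O ∩ ℓ ⁻¹' (thickening δ C) ⊆ N := by
    rintro C hCC z ⟨hz, hzC⟩
    apply hδN
    apply thickening_mono (min_le_left δ₁ δ₂)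
    rw [hOm] at hz
    obtain ⟨c, hc, hcd⟩ := mem_thickening_iff.1 hzC
    have hc' := hCC hc
    rw [← hC] at hc'
    have : ∀ i, ∃ r ∈ R i, (i = j → r = u⁻¹ * c) ∧ dist (z i) r < δ := by
      intro i
      by_cases hi : i = j
      · subst hi
        refine ⟨u⁻¹ * c, hc'.2, fun _ => rfl, ?_⟩
        have : z i - u⁻¹ * c = u⁻¹ * (ℓ z - c) := by rw [hℓa]; field_simp
        rw [dist_eq_norm, this, norm_mul, norm_inv, hu, inv_one, one_mul, ← dist_eq_norm]
        exact hcd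
      · obtain ⟨r, hr, hrd⟩ := mem_thickening_iff.1 (hz i hi)
        exact ⟨r, hr, fun h => absurd h hi, hrd⟩
    choose r hr hrj hrd using this
    refine mem_thickening_iff.2 ⟨r, ⟨fun i _ => hr i, ?_⟩, (dist_pi_lt_iff hδ).2 hrd⟩
    rw [mem_setOf_eq, hrj j rfl, mul_inv_cancel_left₀ hu0]
    exact hc'.1
  have hCv : ∀ ζ ∈ C₁ ∪ C₂, ζ.re = v := fun ζ hζ => (hC.symm ▸ hζ : ζ ∈ {ζ : ℂ | _}).1
  obtain ⟨D₁, Q₁, a₁, b₁, hD₁, hDT₁, hDC₁, hQ₁, hCQ₁, hQT₁, ha₁, hb₁, ha₁0, hb₁0, he₁, he₁'⟩ :=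
    mult_split1 he hO hOc hOe h1 h1c (fun ζ hζ => hCv ζ (Or.inl hζ)) hδ
      (hf.mono (hNm C₁ subset_union_left)) (fun z hz => hf0 z (hNm C₁ subset_union_left hz))
  obtain ⟨D₂, Q₂, a₂, b₂, hD₂, hDT₂, hDC₂, hQ₂, hCQ₂, hQT₂, ha₂, hb₂, ha₂0, hb₂0, he₂, he₂'⟩ :=
    mult_split1 he hO hOc hOe h2 h2c (fun ζ hζ => hCv ζ (Or.inr hζ)) hδ
      (hf.mono (hNm C₂ subset_union_right)) (fun z hz => hf0 z (hNm C₂ subset_union_right hz))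
  have hcr : Continuous fun z => (ℓ z).re := Complex.continuous_re.comp ℓ.continuous
  -- points of `R j` on the line avoid `D₁ ∪ D₂`
  have havoid : ∀ z ∈ pi univ R, (ℓ z).re = v → ℓ z ∉ D₁ ∧ ℓ z ∉ D₂ := by
    intro z hz hzv
    have hmem : ℓ z ∈ C₁ ∪ C₂ := by
      rw [← hC]
      refine ⟨hzv, ?_⟩
      rw [hℓa, inv_mul_cancel_left₀ hu0]; exact hz j (mem_univ j)
    rcases hmem with h | h
    · exact ⟨fun h' => Set.disjoint_left.1 hDC₁ h' h,
        fun h' => Set.disjoint_left.1 hTd (hT1 h) (hDT₂ h')⟩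
    · exact ⟨fun h' => Set.disjoint_left.1 hTd (hDT₁ h') (hT2 h),
        fun h' => Set.disjoint_left.1 hDC₂ h' h⟩
  refine ⟨O ∩ {z | ¬ (ℓ z ∈ D₁ ∧ v ≤ (ℓ z).re)} ∩ {z | ¬ (ℓ z ∈ D₂ ∧ v ≤ (ℓ z).re)},
    O ∩ {z | ¬ (ℓ z ∈ D₁ ∧ (ℓ z).re ≤ v)} ∩ {z | ¬ (ℓ z ∈ D₂ ∧ (ℓ z).re ≤ v)},
    O ∩ ℓ ⁻¹' (Q₁ ∪ Q₂), fun z => a₁ z * a₂ z, fun z => b₁ z * b₂ z, ?_, ?_, ?_, ?_, ?_, ?_,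
    ?_, ?_, ?_, ?_, ?_⟩
  · refine (hO.inter (isOpen_compl_iff.2 ?_)).inter (isOpen_compl_iff.2 ?_)
    · exact (hD₁.preimage ℓ.continuous).inter (isClosed_le continuous_const hcr)
    · exact (hD₂.preimage ℓ.continuous).inter (isClosed_le continuous_const hcr)
  · refine (hO.inter (isOpen_compl_iff.2 ?_)).inter (isOpen_compl_iff.2 ?_)
    · exact (hD₁.preimage ℓ.continuous).inter (isClosed_le hcr continuous_const)
    · exact (hD₂.preimage ℓ.continuous).inter (isClosed_le hcr continuous_const)
  · exact hO.inter ((hQ₁.union hQ₂).preimage ℓ.continuous)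
  · rintro z ⟨hz, hzv⟩
    rw [mem_setOf_eq, ← hℓa] at hzv
    exact ⟨⟨hSO hz, fun h => (havoid z hz (le_antisymm hzv h.2)).1 h.1⟩,
      fun h => (havoid z hz (le_antisymm hzv h.2)).2 h.1⟩
  · rintro z ⟨hz, hzv⟩
    rw [mem_setOf_eq, ← hℓa] at hzv
    exact ⟨⟨hSO hz, fun h => (havoid z hz (le_antisymm h.2 hzv)).1 h.1⟩,
      fun h => (havoid z hz (le_antisymm h.2 hzv)).2 h.1⟩
  · rintro z ⟨⟨hz, hzv⟩, -, hzv'⟩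
    rw [mem_setOf_eq, ← hℓa] at hzv hzv'
    have hmem : ℓ z ∈ C₁ ∪ C₂ := by
      rw [← hC]
      refine ⟨le_antisymm hzv hzv', ?_⟩
      rw [hℓa, inv_mul_cancel_left₀ hu0]; exact hz j (mem_univ j)
    exact ⟨hSO hz, hmem.imp (fun h => hCQ₁ h) (fun h => hCQ₂ h)⟩
  · exact (ha₁.mono fun z hz => ⟨hz.1.1, hz.1.2⟩).mul (ha₂.mono fun z hz => ⟨hz.1.1, hz.2⟩)
  · exact (hb₁.mono fun z hz => ⟨hz.1.1, hz.1.2⟩).mul (hb₂.mono fun z hz => ⟨hz.1.1, hz.2⟩)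
  · exact fun z => mul_ne_zero (ha₁0 z) (ha₂0 z)
  · exact fun z => mul_ne_zero (hb₁0 z) (hb₂0 z)
  · rintro z ⟨-, hz, hQ⟩
    rcases hQ with h | h
    · have := he₂' z hz fun h' => Set.disjoint_left.1 hTd (hQT₁ h) h'
      simp only
      rw [he₁ z hz h, this]; ring
    · have := he₁' z hz fun h' => Set.disjoint_left.1 hTd h' (hQT₂ h)
      simp only
      rw [he₂ z hz h, this]; ring
end PPD

namespace PPD
open Filter Topology MeasureTheory

/-- a holomorphic nowhere vanishing cocycle -/
structure Coc {n : ℕ} {ι : Type} (U : ι → Set (Fin n → ℂ))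
    (g : ι → ι → (Fin n → ℂ) → ℂ) : Prop where
  op : ∀ i, IsOpen (U i)
  hol : ∀ i j, DifferentiableOn ℂ (g i j) (U i ∩ U j)
  ne : ∀ i j, ∀ z ∈ U i ∩ U j, g i j z ≠ 0
  coc : ∀ i j l, ∀ z ∈ U i ∩ U j ∩ U l, g i j z * g j l z = g i l z

/-- `φ` trivializes the cocycle over `W` -/
structure TrivOn {n : ℕ} {ι : Type} (U : ι → Set (Fin n → ℂ))
    (g : ι → ι → (Fin n → ℂ) → ℂ) (W : Set (Fin n → ℂ)) (φ : ι → (Fin n → ℂ) → ℂ) : Prop where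
  hol : ∀ i, DifferentiableOn ℂ (φ i) (U i ∩ W)
  ne : ∀ i, ∀ z ∈ U i ∩ W, φ i z ≠ 0
  eq : ∀ i j, ∀ z ∈ U i ∩ U j ∩ W, φ i z = g i j z * φ j z

/-- the cocycle is trivial near `S` -/
def TrivNear {n : ℕ} {ι : Type} (U : ι → Set (Fin n → ℂ))
    (g : ι → ι → (Fin n → ℂ) → ℂ) (S : Set (Fin n → ℂ)) : Prop :=
  ∃ W φ, IsOpen W ∧ S ⊆ W ∧ W ⊆ ⋃ i, U i ∧ TrivOn U g W φ

theorem holo_div {E : Type*} [NormedAddCommGroup E] [NormedSpace ℂ E] {V : Set E} {f h : E → ℂ}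
    (hf : DifferentiableOn ℂ f V) (hh : DifferentiableOn ℂ h V) (h0 : ∀ z ∈ V, h z ≠ 0) :
    DifferentiableOn ℂ (fun z => f z / h z) V := by
  simp only [div_eq_mul_inv]
  exact hf.mul (hh.fun_inv h0)

variable {n : ℕ} {ι : Type} {U : ι → Set (Fin n → ℂ)} {g : ι → ι → (Fin n → ℂ) → ℂ}

theorem TrivOn.mono {W W' : Set (Fin n → ℂ)} {φ} (h : TrivOn U g W φ) (hW : W' ⊆ W) :
    TrivOn U g W' φ :=
  ⟨fun i => (h.hol i).mono (inter_subset_inter_right _ hW),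
    fun i z hz => h.ne i z ⟨hz.1, hW hz.2⟩, fun i j z hz => h.eq i j z ⟨hz.1, hW hz.2⟩⟩

theorem TrivNear.mono {S S' : Set (Fin n → ℂ)} (h : TrivNear U g S) (hS : S' ⊆ S) :
    TrivNear U g S' := by
  obtain ⟨W, φ, h1, h2, h3, h4⟩ := h
  exact ⟨W, φ, h1, hS.trans h2, h3, h4⟩

theorem trivNear_empty : TrivNear U g ∅ :=
  ⟨∅, fun _ _ => 1, by simp, by simp, by simp, by constructor <;> simp⟩

theorem trivNear_singleton (hc : Coc U g) {x : Fin n → ℂ} (hx : x ∈ ⋃ i, U i) :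
    TrivNear U g {x} := by
  obtain ⟨i0, hi0⟩ := mem_iUnion.1 hx
  refine ⟨U i0, fun i => g i i0, hc.op i0, by simpa using hi0, subset_iUnion _ _, fun i => hc.hol _ _,
    fun i z hz => hc.ne _ _ z hz, fun i j z hz => (hc.coc i j i0 z hz).symm⟩

theorem TrivOn.ratio (hc : Coc U g) {W : Set (Fin n → ℂ)} (hW : IsOpen W) (hWU : W ⊆ ⋃ i, U i)
    {φ₁ φ₂} (h1 : TrivOn U g W φ₁) (h2 : TrivOn U g W φ₂) :
    ∃ f : (Fin n → ℂ) → ℂ, DifferentiableOn ℂ f W ∧ (∀ z ∈ W, f z ≠ 0) ∧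
      ∀ i, ∀ z ∈ U i ∩ W, φ₁ i z = f z * φ₂ i z := by
  classical
  rcases W.eq_empty_or_nonempty with rfl | ⟨y, hy⟩
  · exact ⟨fun _ => 1, by simp, by simp, by simp⟩
  obtain ⟨i₀, -⟩ := mem_iUnion.1 (hWU hy)
  have hex : ∀ z, ∃ i, z ∈ W → z ∈ U i := by
    intro z
    by_cases hz : z ∈ W
    · obtain ⟨i, hi⟩ := mem_iUnion.1 (hWU hz)
      exact ⟨i, fun _ => hi⟩
    · exact ⟨i₀, fun h => absurd h hz⟩
  choose c hcz using hex
  have key : ∀ i, ∀ z ∈ U i ∩ W, φ₁ (c z) z / φ₂ (c z) z = φ₁ i z / φ₂ i z := by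
    intro i z hz
    have e1 := h1.eq i (c z) z ⟨⟨hz.1, hcz z hz.2⟩, hz.2⟩
    have e2 := h2.eq i (c z) z ⟨⟨hz.1, hcz z hz.2⟩, hz.2⟩
    have e3 := hc.ne i (c z) z ⟨hz.1, hcz z hz.2⟩
    rw [e1, e2, mul_div_mul_left _ _ e3]
  refine ⟨fun z => φ₁ (c z) z / φ₂ (c z) z, ?_, ?_, ?_⟩
  · intro z hz
    have hzc := hcz z hz
    have : DifferentiableOn ℂ (fun w => φ₁ (c z) w / φ₂ (c z) w) (U (c z) ∩ W) :=
      holo_div (h1.hol _) (h2.hol _) (h2.ne _)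
    have h3 : DifferentiableOn ℂ (fun z => φ₁ (c z) z / φ₂ (c z) z) (U (c z) ∩ W) :=
      this.congr fun w hw => key _ w hw
    exact (h3.differentiableAt (((hc.op _).inter hW).mem_nhds ⟨hzc, hz⟩)).differentiableWithinAt
  · intro z hz
    exact div_ne_zero (h1.ne _ z ⟨hcz z hz, hz⟩) (h2.ne _ z ⟨hcz z hz, hz⟩)
  · intro i z hz
    show _ = φ₁ (c z) z / φ₂ (c z) z * _
    rw [key i z hz, div_mul_cancel₀ _ (h2.ne i z hz)]

theorem TrivNear.glue (hc : Coc U g) {A₀ B₀ : Set (Fin n → ℂ)} (hA₀ : IsCompact A₀)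
    (hB₀ : IsCompact B₀) (hA : TrivNear U g A₀) (hB : TrivNear U g B₀) (hs : Split A₀ B₀) :
    TrivNear U g (A₀ ∪ B₀) := by
  classical
  obtain ⟨W1, φ₁, hW1, hAW, hWU1, ht1⟩ := hA
  obtain ⟨W2, φ₂, hW2, hBW, hWU2, ht2⟩ := hB
  obtain ⟨f, hf, hf0, hfe⟩ := TrivOn.ratio hc (hW1.inter hW2) (inter_subset_left.trans hWU1)
    (ht1.mono inter_subset_left) (ht2.mono inter_subset_right)
  obtain ⟨A, B, G, a, b, hAo, hBo, hGo, hA, hB, hG, ha, hb, ha0, hb0, hab⟩ :=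
    hs (W1 ∩ W2) (hW1.inter hW2) (fun z hz => ⟨hAW hz.1, hBW hz.2⟩) f hf hf0
  obtain ⟨P, Q, hP, hQ, hAP, hBQ, hPQ⟩ := SeparatedNhds.of_isCompact_isCompact
    (hA₀.diff hGo) hB₀ (by
      rw [Set.disjoint_left]; intro z hz hz'; exact hz.2 (hG ⟨hz.1, hz'⟩))
  set A' := (P ∪ G) ∩ A ∩ W1
  set B' := Q ∩ B ∩ W2
  have hA'o : IsOpen A' := ((hP.union hGo).inter hAo).inter hW1
  have hB'o : IsOpen B' := (hQ.inter hBo).inter hW2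
  have hAB : ∀ z ∈ A', z ∈ B' → a z = f z * b z := by
    rintro z ⟨⟨h1, h2⟩, h3⟩ ⟨⟨h4, h5⟩, h6⟩
    refine hab z ⟨⟨h2, h5⟩, ?_⟩
    rcases h1 with h | h
    · exact absurd h4 (Set.disjoint_left.1 hPQ h)
    · exact h
  have key : ∀ i, ∀ z ∈ U i, z ∈ A' → z ∈ B' → φ₁ i z / a z = φ₂ i z / b z := by
    intro i z hi h1 h2
    rw [hfe i z ⟨hi, h1.2, h2.2⟩, hAB z h1 h2, mul_div_mul_left _ _ (hf0 z ⟨h1.2, h2.2⟩)]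
  set φ : ι → (Fin n → ℂ) → ℂ := fun i z => if z ∈ A' then φ₁ i z / a z else φ₂ i z / b z with hφ
  have eA : ∀ i z, z ∈ A' → φ i z = φ₁ i z / a z := fun i z h => if_pos h
  have eB : ∀ i, ∀ z ∈ U i, z ∈ B' → φ i z = φ₂ i z / b z := by
    intro i z hi h
    by_cases h' : z ∈ A'
    · rw [eA i z h', key i z hi h' h]
    · exact if_neg h'
  refine ⟨A' ∪ B', φ, hA'o.union hB'o, ?_, ?_, ?_, ?_, ?_⟩
  · rintro z (hz | hz)
    · left
      refine ⟨⟨?_, hA hz⟩, hAW hz⟩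
      by_cases h : z ∈ G
      · exact Or.inr h
      · exact Or.inl (hAP ⟨hz, h⟩)
    · exact Or.inr ⟨⟨hBQ hz, hB hz⟩, hBW hz⟩
  · rintro z (hz | hz)
    · exact hWU1 hz.2
    · exact hWU2 hz.2
  · rintro i z ⟨hi, hz⟩
    apply DifferentiableAt.differentiableWithinAt
    rcases hz with hz | hz
    · have : DifferentiableOn ℂ (φ i) (U i ∩ A') :=
        DifferentiableOn.congr (holo_div ((ht1.hol i).mono fun w hw => ⟨hw.1, hw.2.2⟩)
          (ha.mono fun w hw => hw.2.1.2) (fun w _ => ha0 w)) fun w hw => eA i w hw.2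
      exact this.differentiableAt (((hc.op i).inter hA'o).mem_nhds ⟨hi, hz⟩)
    · have : DifferentiableOn ℂ (φ i) (U i ∩ B') :=
        DifferentiableOn.congr (holo_div ((ht2.hol i).mono fun w hw => ⟨hw.1, hw.2.2⟩)
          (hb.mono fun w hw => hw.2.1.2) (fun w _ => hb0 w)) fun w hw => eB i w hw.1 hw.2
      exact this.differentiableAt (((hc.op i).inter hB'o).mem_nhds ⟨hi, hz⟩)
  · rintro i z ⟨hi, hz | hz⟩
    · rw [eA i z hz]
      exact div_ne_zero (ht1.ne i z ⟨hi, hz.2⟩) (ha0 z)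
    · rw [eB i z hi hz]
      exact div_ne_zero (ht2.ne i z ⟨hi, hz.2⟩) (hb0 z)
  · rintro i j z ⟨hi, hz | hz⟩
    · rw [eA i z hz, eA j z hz, ht1.eq i j z ⟨hi, hz.2⟩, mul_div_assoc]
    · rw [eB i z hi.1 hz, eB j z hi.2 hz, ht2.eq i j z ⟨hi, hz.2⟩, mul_div_assoc]

theorem Split.mono {A₀ B₀ A₁ B₁ : Set (Fin n → ℂ)} (h : Split A₀ B₀) (hA : A₁ ⊆ A₀) (hB : B₁ ⊆ B₀)
    (hAB : A₀ ∩ B₀ ⊆ A₁ ∩ B₁) : Split A₁ B₁ := by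
  intro N hN hs f hf hf0
  obtain ⟨A, B, G, a, b, h1, h2, h3, h4, h5, h6, h7⟩ := h N hN (hAB.trans hs) f hf hf0
  exact ⟨A, B, G, a, b, h1, h2, h3, hA.trans h4, hB.trans h5,
    (inter_subset_inter hA hB).trans h6, h7⟩

theorem TrivNear.slice (hc : Coc U g) {S : Set (Fin n → ℂ)} (hS : IsCompact S)
    {ρ : (Fin n → ℂ) → ℝ} (hρ : Continuous ρ) (ht : ∀ t, TrivNear U g (S ∩ {z | ρ z = t}))
    (hs : ∀ v, Split (S ∩ {z | ρ z ≤ v}) (S ∩ {z | v ≤ ρ z})) : TrivNear U g S := by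
  have hloc : ∀ t, ∃ V : Set ℝ, IsOpen V ∧ t ∈ V ∧ TrivNear U g (S ∩ ρ ⁻¹' V) := by
    intro t
    obtain ⟨W, φ, hW, hSW, hWU, hφ⟩ := ht t
    refine ⟨(ρ '' (S \ W))ᶜ, ((hS.diff hW).image hρ).isClosed.isOpen_compl, ?_, W, φ, hW, ?_, hWU, hφ⟩
    · rintro ⟨z, hz, hzt⟩
      exact hz.2 (hSW ⟨hz.1, hzt⟩)
    · rintro z ⟨hz, hzV⟩
      by_contra h
      exact hzV ⟨z, ⟨hz, h⟩, rfl⟩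
  choose V hVo hVt hVT using hloc
  obtain ⟨p, hp⟩ := ((hS.image hρ).bddBelow)
  obtain ⟨q, hq⟩ := ((hS.image hρ).bddAbove)
  have hSp : ∀ z ∈ S, p ≤ ρ z := fun z hz => hp (mem_image_of_mem _ hz)
  have hSq : ∀ z ∈ S, ρ z ≤ q := fun z hz => hq (mem_image_of_mem _ hz)
  rcases S.eq_empty_or_nonempty with rfl | ⟨z0, hz0⟩
  · exact trivNear_empty
  have hpq : p ≤ q := (hSp z0 hz0).trans (hSq z0 hz0)
  obtain ⟨t, ht0, htm, ⟨m, htq⟩, htV⟩ := exists_monotone_Icc_subset_open_cover_Icc hpq (c := fun x => Subtype.val ⁻¹' V x)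
    (fun x => (hVo x).preimage continuous_subtype_val) (fun x _ => mem_iUnion.2 ⟨x, hVt x⟩)
  have hind : ∀ k : ℕ, TrivNear U g (S ∩ {z | ρ z ≤ t k}) := by
    intro k
    induction k with
    | zero =>
      refine (ht (t 0)).mono fun z hz => ⟨hz.1, le_antisymm hz.2 ?_⟩
      rw [ht0]; exact hSp z hz.1
    | succ k ih =>
      have hle : (t k : ℝ) ≤ t (k+1) := htm (Nat.le_succ k)
      obtain ⟨x, hx⟩ := htV k
      have hB : TrivNear U g (S ∩ {z | t k ≤ ρ z ∧ ρ z ≤ t (k+1)}) :=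
        (hVT x).mono fun z hz => ⟨hz.1, hx (show (⟨ρ z, hSp z hz.1, hSq z hz.1⟩ : Icc p q) ∈ _ from hz.2)⟩
      have := TrivNear.glue hc (hS.inter_right (isClosed_le hρ continuous_const))
        (hS.inter_right ((isClosed_le continuous_const hρ).inter (isClosed_le hρ continuous_const)))
        ih hB ((hs (t k)).mono subset_rfl (fun z hz => ⟨hz.1, hz.2.1⟩)
          (fun z hz => ⟨hz.1, hz.2.1, hz.2.2, hz.1.2.trans hle⟩))
      refine this.mono fun z hz => ?_
      rcases le_total (ρ z) (t k) with h | h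
      · exact Or.inl ⟨hz.1, h⟩
      · exact Or.inr ⟨hz.1, h, hz.2⟩
  refine (hind m).mono fun z hz => ⟨hz, ?_⟩
  show ρ z ≤ t m
  rw [htq m le_rfl]; exact hSq z hz

end PPD

namespace PPD
open Filter Topology MeasureTheory

theorem coordTriv {n : ℕ} {ι : Type} {U : ι → Set (Fin n → ℂ)} {g : ι → ι → (Fin n → ℂ) → ℂ}
    (hc : Coc U g) {R : Fin n → Set ℂ} (hR : ∀ i, IsCompact (R i)) (j : Fin n)
    (hRc : ∀ i, i ≠ j → Convex ℝ (R i))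
    (hsl : ∀ t : ℝ, ∃ C₁ C₂ : Set ℂ, IsCompact C₁ ∧ IsCompact C₂ ∧ Convex ℝ C₁ ∧ Convex ℝ C₂ ∧
      Disjoint C₁ C₂ ∧ {ζ : ℂ | ζ.re = t ∧ ζ ∈ R j} = C₁ ∪ C₂)
    (hpt : ∀ x ∈ R j, TrivNear U g (pi univ (Function.update R j {x}))) :
    TrivNear U g (pi univ R) := by
  classical
  refine TrivNear.slice hc (isCompact_univ_pi hR) (ρ := fun z => ((1:ℂ) * z j).re) (by fun_prop) ?_ ?_
  swap
  · intro v
    obtain ⟨C₁, C₂, h1, h2, h3, h4, h5, h6⟩ := hsl v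
    refine box_split hR j hRc (by simp) v h1 h2 h3 h4 h5 ?_
    simpa using h6
  intro t
  set R' := Function.update R j (R j ∩ {ζ | ζ.re = t}) with hR'
  have hR'c : ∀ i, IsCompact (R' i) := by
    intro i
    by_cases hi : i = j
    · subst hi
      rw [hR', Function.update_self]
      exact (hR i).inter_right (isClosed_eq Complex.continuous_re continuous_const)
    · rw [hR', Function.update_of_ne hi]; exact hR i
  have hmem : ∀ z, z ∈ pi univ R' → z ∈ pi univ R ∧ (z j).re = t := by
    intro z hz
    have hj := hz j (mem_univ _)
    rw [hR', Function.update_self] at hj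
    refine ⟨fun i _ => ?_, hj.2⟩
    by_cases hi : i = j
    · subst hi; exact hj.1
    · have := hz i (mem_univ _)
      rwa [hR', Function.update_of_ne hi] at this
  have main : TrivNear U g (pi univ R') := by
    refine TrivNear.slice hc (isCompact_univ_pi hR'c) (ρ := fun z => ((-Complex.I) * z j).re)
      (by fun_prop) ?_ ?_
    swap
    · intro v
      have hss : {ζ : ℂ | ζ.re = v ∧ (-Complex.I)⁻¹ * ζ ∈ R' j}.Subsingleton := by
        rintro ζ ⟨h1, h2⟩ ξ ⟨h3, h4⟩
        rw [hR', Function.update_self] at h2 h4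
        have h5 := h2.2
        have h6 := h4.2
        simp at h5 h6
        apply Complex.ext
        · rw [h1, h3]
        · linarith
      refine box_split hR'c j ?_ (by simp) v (C₁ := {ζ : ℂ | ζ.re = v ∧ (-Complex.I)⁻¹ * ζ ∈ R' j})
        (C₂ := ∅) hss.finite.isCompact isCompact_empty hss.convex convex_empty (by simp) (by simp)
      intro i hi
      rw [hR', Function.update_of_ne hi]
      exact hRc i hi
    · intro s
      by_cases hx : (⟨t, s⟩ : ℂ) ∈ R j
      · refine (hpt _ hx).mono ?_
        rintro z ⟨hz, hzs⟩ i -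
        obtain ⟨h1, h2⟩ := hmem z hz
        have h3 : (z j).im = s := by simpa using hzs
        by_cases hi : i = j
        · subst hi
          rw [Function.update_self]
          exact Complex.ext h2 h3
        · rw [Function.update_of_ne hi]; exact h1 i (mem_univ _)
      · refine trivNear_empty.mono ?_
        rintro z ⟨hz, hzs⟩
        obtain ⟨h1, h2⟩ := hmem z hz
        have h3 : (z j).im = s := by simpa using hzs
        have : z j = ⟨t, s⟩ := Complex.ext h2 h3
        exact hx (this ▸ h1 j (mem_univ _))
  refine main.mono ?_
  rintro z ⟨hz, hzt⟩ i -
  by_cases hi : i = j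
  · subst hi
    rw [hR', Function.update_self]
    exact ⟨hz i (mem_univ _), by simpa using hzt⟩
  · rw [hR', Function.update_of_ne hi]; exact hz i (mem_univ _)

theorem convexTriv {n : ℕ} {ι : Type} {U : ι → Set (Fin n → ℂ)} {g : ι → ι → (Fin n → ℂ) → ℂ}
    (hc : Coc U g) {R : Fin n → Set ℂ} (hR : ∀ i, IsCompact (R i)) 
    (hRc : ∀ i, Convex ℝ (R i)) (hRU : pi univ R ⊆ ⋃ i, U i) :
    TrivNear U g (pi univ R) := by
  classical
  have key : ∀ s : Finset (Fin n), ∀ R : Fin n → Set ℂ, (∀ i, IsCompact (R i)) →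
      (∀ i, Convex ℝ (R i)) → (pi univ R ⊆ ⋃ i, U i) → (∀ i ∉ s, (R i).Subsingleton) →
      TrivNear U g (pi univ R) := by
    intro s
    induction s using Finset.induction_on with
    | empty =>
      intro R hR hRc hRU hs
      have : (pi univ R).Subsingleton := fun x hx y hy => funext fun i =>
        hs i (by simp) (hx i (mem_univ _)) (hy i (mem_univ _))
      rcases this.eq_empty_or_singleton with h | ⟨x, h⟩
      · rw [h]; exact trivNear_empty
      · rw [h] at hRU ⊢; exact trivNear_singleton hc (by simpa using hRU)
    | insert j s hj ih =>
      intro R hR hRc hRU hs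
      refine coordTriv hc hR j (fun i _ => hRc i) ?_ ?_
      · intro t
        refine ⟨{ζ : ℂ | ζ.re = t ∧ ζ ∈ R j}, ∅, ?_, isCompact_empty, ?_, convex_empty, by simp, by simp⟩
        · exact (hR j).inter_left (isClosed_eq Complex.continuous_re continuous_const)
        · exact (convex_hyperplane (Complex.reCLM.toLinearMap.isLinear) t).inter (hRc j)
      · intro x hx
        refine ih _ ?_ ?_ ?_ ?_
        · intro i
          by_cases hi : i = j
          · subst hi; simp
          · rw [Function.update_of_ne hi]; exact hR i
        · intro i
          by_cases hi : i = j
          · subst hi; simp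
          · rw [Function.update_of_ne hi]; exact hRc i
        · refine Subset.trans ?_ hRU
          intro z hz i _
          have := hz i (mem_univ _)
          by_cases hi : i = j
          · subst hi
            rw [Function.update_self] at this
            rw [this]; exact hx
          · rwa [Function.update_of_ne hi] at this
        · intro i his
          by_cases hi : i = j
          · subst hi; simp
          · rw [Function.update_of_ne hi]; exact hs i (by simp [hi, his])
  exact key Finset.univ R hR hRc hRU (by simp)

theorem annulus_slice (a b : ℝ) (ha : 0 < a) (t : ℝ) :
    ∃ C₁ C₂ : Set ℂ, IsCompact C₁ ∧ IsCompact C₂ ∧ Convex ℝ C₁ ∧ Convex ℝ C₂ ∧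
      Disjoint C₁ C₂ ∧ {ζ : ℂ | ζ.re = t ∧ ζ ∈ closedBall (0:ℂ) b \ ball 0 a} = C₁ ∪ C₂ := by
  have hL : Convex ℝ {ζ : ℂ | ζ.re = t} := convex_hyperplane (Complex.reCLM.toLinearMap.isLinear) t
  have hLc : IsClosed {ζ : ℂ | ζ.re = t} := isClosed_eq Complex.continuous_re continuous_const
  have hn : ∀ ζ : ℂ, ζ.re = t → (a ≤ ‖ζ‖ ↔ a ^ 2 - t ^ 2 ≤ ζ.im ^ 2) := by
    intro ζ hζ
    rw [← sq_le_sq₀ ha.le (norm_nonneg _), Complex.sq_norm, Complex.normSq_apply, hζ]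
    constructor <;> intro h <;> nlinarith
  by_cases hta : a ^ 2 ≤ t ^ 2
  · refine ⟨{ζ | ζ.re = t} ∩ closedBall 0 b, ∅, (isCompact_closedBall _ _).inter_left hLc,
      isCompact_empty, hL.inter (convex_closedBall _ _), convex_empty, by simp, ?_⟩
    ext ζ
    simp only [mem_ofPred_eq, Set.mem_sdiff, mem_inter_iff, union_empty, mem_ball, dist_zero_right, not_lt]
    constructor
    · rintro ⟨h1, h2, h3⟩; exact ⟨h1, h2⟩
    · rintro ⟨h1, h2⟩; exact ⟨h1, h2, (hn ζ h1).2 (by nlinarith [sq_nonneg ζ.im])⟩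
  · push Not at hta
    set c := Real.sqrt (a ^ 2 - t ^ 2) with hcdef
    have hc0 : 0 < c := Real.sqrt_pos.2 (by linarith)
    have hc2 : c ^ 2 = a ^ 2 - t ^ 2 := Real.sq_sqrt (by linarith)
    refine ⟨({ζ | ζ.re = t} ∩ {ζ | c ≤ ζ.im}) ∩ closedBall 0 b,
      ({ζ | ζ.re = t} ∩ {ζ | ζ.im ≤ -c}) ∩ closedBall 0 b,
      (isCompact_closedBall _ _).inter_left (hLc.inter (isClosed_le continuous_const Complex.continuous_im)),
      (isCompact_closedBall _ _).inter_left (hLc.inter (isClosed_le Complex.continuous_im continuous_const)),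
      (hL.inter (convex_halfSpace_ge (Complex.imCLM.toLinearMap.isLinear) c)).inter (convex_closedBall _ _),
      (hL.inter (convex_halfSpace_le (Complex.imCLM.toLinearMap.isLinear) (-c))).inter (convex_closedBall _ _),
      ?_, ?_⟩
    · rw [Set.disjoint_left]
      rintro ζ ⟨⟨h1, h2⟩, h3⟩ ⟨⟨h4, h5⟩, h6⟩
      have h2' : c ≤ ζ.im := h2
      have h5' : ζ.im ≤ -c := h5
      linarith
    · ext ζ
      simp only [mem_ofPred_eq, Set.mem_sdiff, mem_inter_iff, mem_union, mem_ball, dist_zero_right, not_lt]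
      constructor
      · rintro ⟨h1, h2, h3⟩
        rw [hn ζ h1, ← hc2, sq_le_sq, abs_of_pos hc0, le_abs] at h3
        rcases h3 with h | h
        · exact Or.inl ⟨⟨h1, h⟩, h2⟩
        · exact Or.inr ⟨⟨h1, by linarith⟩, h2⟩
      · rintro (⟨⟨h1, h2⟩, h3⟩ | ⟨⟨h1, h2⟩, h3⟩)
        · exact ⟨h1, h3, (hn ζ h1).2 (by nlinarith)⟩
        · exact ⟨h1, h3, (hn ζ h1).2 (by nlinarith)⟩

/-- closed polyannulus -/
def KK (k : ℕ) (a b : ℝ) : Set (Fin (k+1) → ℂ) := {z | (∀ j, ‖z j‖ ≤ b) ∧ a ≤ ‖z 0‖}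

theorem trivNear_KK {k : ℕ} {ι : Type} {U : ι → Set (Fin (k+1) → ℂ)}
    {g : ι → ι → (Fin (k+1) → ℂ) → ℂ} (hc : Coc U g) {a b : ℝ} (ha : 0 < a)
    (hU : KK k a b ⊆ ⋃ i, U i) : TrivNear U g (KK k a b) := by
  classical
  set R : Fin (k+1) → Set ℂ := Function.update (fun _ => closedBall 0 b) 0 (closedBall 0 b \ ball 0 a)
    with hRd
  have hR0 : R 0 = closedBall 0 b \ ball 0 a := by rw [hRd, Function.update_self]
  have hRi : ∀ i, i ≠ 0 → R i = closedBall 0 b := fun i hi => by rw [hRd, Function.update_of_ne hi]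
  have hKR : KK k a b = pi univ R := by
    ext z
    simp only [KK, mem_ofPred_eq, Set.mem_pi, mem_univ, true_imp_iff]
    constructor
    · rintro ⟨h1, h2⟩ i
      by_cases hi : i = 0
      · subst hi; rw [hR0]; simp [h1, h2]
      · rw [hRi i hi]; simp [h1]
    · intro h
      have h0 := h 0
      rw [hR0] at h0
      simp at h0
      refine ⟨fun i => ?_, h0.2⟩
      by_cases hi : i = 0
      · subst hi; exact h0.1
      · have := h i; rw [hRi i hi] at this; simpa using this
  rw [hKR] at hU ⊢
  have hRc : ∀ i, IsCompact (R i) := by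
    intro i
    by_cases hi : i = 0
    · subst hi; rw [hR0]; exact (isCompact_closedBall _ _).diff isOpen_ball
    · rw [hRi i hi]; exact isCompact_closedBall _ _
  have hRv : ∀ i, i ≠ 0 → Convex ℝ (R i) := by
    intro i hi; rw [hRi i hi]; exact convex_closedBall _ _
  refine coordTriv hc hRc 0 hRv ?_ ?_
  · intro t; rw [hR0]; exact annulus_slice a b ha t
  · intro x hx
    refine convexTriv hc ?_ ?_ ?_
    · intro i
      by_cases hi : i = 0
      · subst hi; simp
      · rw [Function.update_of_ne hi]; exact hRc i
    · intro i
      by_cases hi : i = 0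
      · subst hi; simp
      · rw [Function.update_of_ne hi]; exact hRv i hi
    · refine Subset.trans ?_ hU
      intro z hz i _
      have := hz i (mem_univ _)
      by_cases hi : i = 0
      · subst hi
        rw [Function.update_self] at this
        rw [this]; exact hx
      · rwa [Function.update_of_ne hi] at this

end PPD

namespace PPD
open Filter Topology MeasureTheory

theorem geom_ker (N : ℕ) {ζ w : ℂ} (hζ : ζ ≠ 0) (h : ζ ≠ w) :
    (ζ - w)⁻¹ - ∑ m ∈ Finset.range N, w ^ m / ζ ^ (m + 1) = (w / ζ) ^ N * (ζ - w)⁻¹ := by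
  have h' : ζ - w ≠ 0 := sub_ne_zero.2 h
  induction N with
  | zero => simp
  | succ N ih =>
    rw [Finset.sum_range_succ, ← sub_sub, ih, div_pow, div_pow]
    field_simp
    ring

theorem ker_bound {ρ δ d : ℝ} (h0 : 0 ≤ ρ) (h1 : ρ < 1) (hd : 0 < d) (hδ : 0 < δ) :
    ∃ N : ℕ, ρ ^ N * d⁻¹ ≤ δ := by
  obtain ⟨N, hN⟩ := exists_pow_lt_of_lt_one (mul_pos hδ hd) h1
  exact ⟨N, by rw [← div_eq_mul_inv, div_le_iff₀ hd]; exact hN.le⟩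

/-- the Cauchy kernel on the circle of radius `r` can be approximated on `K`
by kernels holomorphic on `Z` -/
def KerApprox (r : ℝ) (Z K : Set ℂ) : Prop :=
  ∀ δ > 0, ∃ κ : ℂ → ℂ → ℂ, ContinuousOn (fun p : ℂ × ℂ => κ p.1 p.2) (sphere 0 r ×ˢ Z) ∧
    (∀ ζ ∈ sphere (0:ℂ) r, DifferentiableOn ℂ (κ ζ) Z) ∧
    ∀ ζ ∈ sphere (0:ℂ) r, ∀ w ∈ K, ‖(ζ - w)⁻¹ - κ ζ w‖ ≤ δ

theorem ker_out {s r : ℝ} (hs : 0 ≤ s) (hsr : s < r) : KerApprox r univ (closedBall 0 s) := by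
  intro δ hδ
  have hr : 0 < r := hs.trans_lt hsr
  obtain ⟨N, hN⟩ := ker_bound (div_nonneg hs hr.le) ((div_lt_one hr).2 hsr) (sub_pos.2 hsr) hδ
  refine ⟨fun ζ w => ∑ m ∈ Finset.range N, w ^ m / ζ ^ (m + 1), ?_, ?_, ?_⟩
  · refine continuousOn_finsetSum _ fun m _ => ContinuousOn.div (by fun_prop) (by fun_prop) ?_
    rintro ⟨ζ, w⟩ ⟨h1, -⟩
    have : ζ ≠ 0 := by rintro rfl; simp at h1; linarith
    exact pow_ne_zero _ this
  · intro ζ _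
    fun_prop
  · intro ζ hζ w hw
    simp at hζ hw
    have h0 : ζ ≠ 0 := by rintro rfl; simp at hζ; linarith
    have hne : ζ ≠ w := by rintro rfl; linarith
    rw [geom_ker N h0 hne, norm_mul, norm_pow, norm_div, norm_inv, hζ]
    refine le_trans ?_ hN
    have : r - s ≤ ‖ζ - w‖ := by
      have := norm_sub_norm_le ζ w; linarith
    have h1 : 0 < r - s := sub_pos.2 hsr
    gcongr

theorem ker_in {s r : ℝ} (hr : 0 < r) (hsr : r < s) : KerApprox r {0}ᶜ {w | s ≤ ‖w‖} := by
  intro δ hδ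
  have hs : 0 < s := hr.trans hsr
  obtain ⟨N, hN⟩ := ker_bound (div_nonneg hr.le hs.le) ((div_lt_one hs).2 hsr) (sub_pos.2 hsr) hδ
  refine ⟨fun ζ w => - ∑ m ∈ Finset.range N, ζ ^ m / w ^ (m + 1), ?_, ?_, ?_⟩
  · refine (continuousOn_finsetSum _ fun m _ => ContinuousOn.div (by fun_prop) (by fun_prop) ?_).neg
    rintro ⟨ζ, w⟩ ⟨-, h1⟩
    exact pow_ne_zero _ (by simpa using h1)
  · intro ζ _
    refine (DifferentiableOn.fun_sum fun m _ => DifferentiableOn.div (by fun_prop) (by fun_prop) ?_).neg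
    intro w hw
    exact pow_ne_zero _ (by simpa using hw)
  · intro ζ hζ w hw
    simp at hζ hw
    have h0 : w ≠ 0 := by rintro rfl; simp at hw; linarith
    have hne : w ≠ ζ := by rintro rfl; linarith
    have e : (ζ - w)⁻¹ - - ∑ m ∈ Finset.range N, ζ ^ m / w ^ (m + 1)
        = -((w - ζ)⁻¹ - ∑ m ∈ Finset.range N, ζ ^ m / w ^ (m + 1)) := by
      rw [← neg_sub w ζ, inv_neg]; ring
    rw [e, norm_neg, geom_ker N h0 hne, norm_mul, norm_pow, norm_div, norm_inv, hζ]
    refine le_trans ?_ hN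
    have : s - r ≤ ‖w - ζ‖ := by
      have := norm_sub_norm_le w ζ; linarith
    have h1 : 0 < s - r := sub_pos.2 hsr
    gcongr

theorem annulus_cauchy {s r : ℝ} (hs : 0 < s) {w : ℂ} (hsw : s < ‖w‖) (hwr : ‖w‖ < r) {V : Set ℂ}
    (hV : IsOpen V) (hsub : closedBall 0 r \ ball 0 s ⊆ V) {f : ℂ → ℂ}
    (hf : DifferentiableOn ℂ f V) :
    (∮ ζ in C(0, r), f ζ * (ζ - w)⁻¹) - (∮ ζ in C(0, s), f ζ * (ζ - w)⁻¹)
      = 2 * Real.pi * Complex.I * f w := by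
  have hsr : s ≤ r := (hsw.trans hwr).le
  have hr : 0 < r := hs.trans_le hsr
  have hwV : w ∈ V := hsub ⟨by simpa using hwr.le, by simpa using hsw.le⟩
  have hd : DifferentiableOn ℂ (dslope f w) V :=
    (Complex.differentiableOn_dslope (hV.mem_nhds hwV)).2 hf
  have h1 := Complex.circleIntegral_eq_of_differentiable_on_annulus_off_countable hs hsr
    (f := dslope f w) (c := 0) countable_empty (hd.continuousOn.mono hsub) (by
      rintro z ⟨hz, -⟩
      refine hd.differentiableAt (hV.mem_nhds (hsub ⟨ball_subset_closedBall hz.1, ?_⟩))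
      exact fun h => hz.2 (ball_subset_closedBall h))
  have key : ∀ t, s ≤ t → t ≤ r → t ≠ ‖w‖ → (∮ ζ in C(0, t), dslope f w ζ)
      = (∮ ζ in C(0, t), f ζ * (ζ - w)⁻¹) - f w * ∮ ζ in C(0, t), (ζ - w)⁻¹ := by
    intro t hst htr htw
    have ht : 0 < t := hs.trans_le hst
    have hne : ∀ ζ ∈ sphere (0:ℂ) t, ζ - w ≠ 0 := by
      intro ζ hζ h
      rw [sub_eq_zero] at h
      subst h
      simp at hζ
      exact htw hζ.symm
    have hsV : sphere (0:ℂ) t ⊆ V := by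
      intro ζ hζ
      simp at hζ
      exact hsub ⟨by simp [hζ, htr], by simp [hζ, hst]⟩
    have hi : ContinuousOn (fun ζ : ℂ => (ζ - w)⁻¹) (sphere 0 t) :=
      ContinuousOn.inv₀ (by fun_prop) hne
    have c1 : CircleIntegrable (fun ζ => f ζ * (ζ - w)⁻¹) 0 t :=
      ((hf.continuousOn.mono hsV).mul hi).circleIntegrable ht.le
    have c2 : CircleIntegrable (fun ζ => f w * (ζ - w)⁻¹) 0 t :=
      (continuousOn_const.mul hi).circleIntegrable ht.le
    rw [← circleIntegral.integral_const_mul, ← circleIntegral.integral_sub c1 c2]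
    refine circleIntegral.integral_congr ht.le fun ζ hζ => ?_
    have := hne ζ hζ
    rw [dslope_of_ne _ (sub_ne_zero.1 this), slope_def_field]
    field_simp
  rw [key r hsr le_rfl hwr.ne', key s le_rfl hsr hsw.ne,
    circleIntegral.integral_sub_inv_of_mem_ball (by simpa using hwr)] at h1
  have h2 : (∮ ζ in C(0, s), (ζ - w)⁻¹) = 0 := by
    have hne : ∀ ζ ∈ closedBall (0:ℂ) s, ζ - w ≠ 0 := by
      intro ζ hζ h
      rw [sub_eq_zero] at h
      subst h
      simp at hζ
      linarith
    apply Complex.circleIntegral_eq_zero_of_differentiable_on_off_countable hs.le countable_empty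
    · exact ContinuousOn.inv₀ (by fun_prop) hne
    · rintro z ⟨hz, -⟩
      exact DifferentiableAt.inv (by fun_prop) (hne z (ball_subset_closedBall hz))
  rw [h2] at h1
  linear_combination h1

end PPD

namespace PPD
open Filter Topology MeasureTheory

theorem update_mem_pi {n : ℕ} {P : Fin n → Set ℂ} {j : Fin n} {Z : Set ℂ} {z : Fin n → ℂ}
    (hz : z ∈ pi univ (Function.update P j Z)) {ζ : ℂ} (hζ : ζ ∈ P j) :
    Function.update z j ζ ∈ pi univ P := by
  intro i _
  by_cases hi : i = j
  · subst hi; rwa [Function.update_self]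
  · rw [Function.update_of_ne hi]
    have := hz i (mem_univ _)
    rwa [Function.update_of_ne hi] at this

theorem isOpen_pi_update {n : ℕ} {P : Fin n → Set ℂ} (hP : ∀ i, IsOpen (P i)) (j : Fin n) {Z : Set ℂ}
    (hZ : IsOpen Z) : IsOpen (pi univ (Function.update P j Z)) := by
  refine isOpen_set_pi finite_univ fun i _ => ?_
  by_cases hi : i = j
  · subst hi; rwa [Function.update_self]
  · rw [Function.update_of_ne hi]; exact hP i

theorem differentiable_update_left {n : ℕ} (j : Fin n) (ζ : ℂ) :
    Differentiable ℂ (fun z : Fin n → ℂ => Function.update z j ζ) := by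
  rw [differentiable_pi]
  intro i
  by_cases hi : i = j
  · subst hi; simp
  · simp only [Function.update_of_ne hi]; fun_prop

theorem differentiable_update_right {n : ℕ} (j : Fin n) (z : Fin n → ℂ) :
    Differentiable ℂ (fun ζ : ℂ => Function.update z j ζ) := by
  rw [differentiable_pi]
  intro i
  by_cases hi : i = j
  · subst hi; simp
  · simp only [Function.update_of_ne hi]; fun_prop

theorem ci_approx {n : ℕ} {P : Fin n → Set ℂ} (hP : ∀ i, IsOpen (P i)) {h : (Fin n → ℂ) → ℂ}
    (hh : DifferentiableOn ℂ h (pi univ P)) (j : Fin n) {r : ℝ} (hr : 0 < r)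
    (hrP : sphere 0 r ⊆ P j) {Z : Set ℂ} (hZ : IsOpen Z) {K : Fin n → Set ℂ}
    (hK : ∀ i, IsCompact (K i)) (hKP : ∀ i, K i ⊆ P i) (hdis : ∀ w ∈ K j, ‖w‖ ≠ r)
    (hker : KerApprox r Z (K j)) {ε : ℝ} (hε : 0 < ε) :
    ∃ H : (Fin n → ℂ) → ℂ, DifferentiableOn ℂ H (pi univ (Function.update P j Z)) ∧
      (∀ z ∈ pi univ K, z j ∈ Z →
        ‖(∮ ζ in C(0, r), h (Function.update z j ζ) * (ζ - z j)⁻¹) - H z‖ ≤ ε) := by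
  have hPo : IsOpen (pi univ P) := isOpen_set_pi finite_univ fun i _ => hP i
  have hcomp : IsCompact (pi univ (Function.update K j (sphere 0 r))) := by
    refine isCompact_univ_pi fun i => ?_
    by_cases hi : i = j
    · subst hi; rw [Function.update_self]; exact isCompact_sphere _ _
    · rw [Function.update_of_ne hi]; exact hK i
  have hsub : pi univ (Function.update K j (sphere 0 r)) ⊆ pi univ P := by
    intro z hz i _
    have := hz i (mem_univ _)
    by_cases hi : i = j
    · subst hi; rw [Function.update_self] at this; exact hrP this
    · rw [Function.update_of_ne hi] at this; exact hKP i this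
  obtain ⟨M, hM⟩ := hcomp.exists_bound_of_continuousOn (hh.continuousOn.mono hsub)
  set M' := max M 1
  have hM' : 0 < M' := lt_max_of_lt_right one_pos
  obtain ⟨κ, hκc, hκd, hκ⟩ := hker (ε / (2 * Real.pi * r * M')) (by positivity)
  have hcm : ∀ θ, circleMap (0:ℂ) r θ ∈ sphere (0:ℂ) r := fun θ => circleMap_mem_sphere _ hr.le θ
  have hupd : Continuous (fun p : ℂ × (Fin n → ℂ) => Function.update p.2 j p.1) :=
    continuous_snd.update j continuous_fst
  refine ⟨fun z => ∮ ζ in C(0, r), h (Function.update z j ζ) * κ ζ (z j), ?_, ?_⟩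
  · unfold circleIntegral
    have hmem : ∀ z ∈ pi univ (Function.update P j Z), z j ∈ Z := by
      intro z hz
      have := hz j (mem_univ _)
      rwa [Function.update_self] at this
    apply holo_interval (isOpen_pi_update hP j hZ) (by positivity)
      (G := fun θ z => deriv (circleMap 0 r) θ • (h (Function.update z j (circleMap 0 r θ)) *
        κ (circleMap 0 r θ) (z j)))
    · have c0 : Continuous (fun p : ℝ × (Fin n → ℂ) => circleMap 0 r p.1) :=
        (continuous_circleMap 0 r).comp continuous_fst
      simp only [smul_eq_mul]
      refine ContinuousOn.fun_mul ?_ (ContinuousOn.fun_mul ?_ ?_)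
      · simp only [deriv_circleMap]
        exact (c0.mul continuous_const).continuousOn
      · refine hh.continuousOn.comp (hupd.comp (c0.prodMk continuous_snd)).continuousOn ?_
        rintro ⟨θ, z⟩ ⟨-, hz⟩
        exact update_mem_pi hz (hrP (hcm θ))
      · refine hκc.comp (c0.prodMk ((continuous_apply j).comp continuous_snd)).continuousOn ?_
        rintro ⟨θ, z⟩ ⟨-, hz⟩
        exact ⟨hcm θ, hmem z hz⟩
    · intro θ _
      simp only [smul_eq_mul]
      refine DifferentiableOn.const_mul (DifferentiableOn.fun_mul ?_ ?_) _
      · refine hh.comp (differentiable_update_left j _).differentiableOn ?_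
        intro z hz
        exact update_mem_pi hz (hrP (hcm θ))
      · exact (hκd _ (hcm θ)).comp (by fun_prop) (fun z hz => hmem z hz)
  · intro z hz hzZ
    have hz' : ∀ ζ ∈ sphere (0:ℂ) r, Function.update z j ζ ∈ pi univ (Function.update K j (sphere 0 r)) := by
      intro ζ hζ i _
      by_cases hi : i = j
      · subst hi; rwa [Function.update_self, Function.update_self]
      · rw [Function.update_of_ne hi, Function.update_of_ne hi]; exact hz i (mem_univ _)
    have hhc : ContinuousOn (fun ζ => h (Function.update z j ζ)) (sphere 0 r) :=
      hh.continuousOn.comp (differentiable_update_right j z).continuous.continuousOn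
        fun ζ hζ => hsub (hz' ζ hζ)
    have hi : ContinuousOn (fun ζ : ℂ => (ζ - z j)⁻¹) (sphere 0 r) := by
      refine ContinuousOn.inv₀ (by fun_prop) ?_
      intro ζ hζ h
      rw [sub_eq_zero] at h
      simp at hζ
      exact hdis (z j) (hz j (mem_univ _)) (h ▸ hζ)
    have hk : ContinuousOn (fun ζ : ℂ => κ ζ (z j)) (sphere 0 r) :=
      hκc.comp (f := fun ζ => (ζ, z j)) (by fun_prop) fun ζ hζ => ⟨hζ, hzZ⟩
    have c1 : CircleIntegrable (fun ζ => h (Function.update z j ζ) * (ζ - z j)⁻¹) 0 r :=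
      (hhc.mul hi).circleIntegrable hr.le
    have c2 : CircleIntegrable (fun ζ => h (Function.update z j ζ) * κ ζ (z j)) 0 r :=
      (hhc.mul hk).circleIntegrable hr.le
    simp only
    rw [← circleIntegral.integral_sub c1 c2]
    refine (circleIntegral.norm_integral_le_of_norm_le_const hr.le
      (C := M' * (ε / (2 * Real.pi * r * M'))) ?_).trans ?_
    · intro ζ hζ
      rw [← mul_sub, norm_mul]
      exact mul_le_mul ((hM _ (hz' ζ hζ)).trans (le_max_left _ _)) (hκ ζ hζ _ (hz j (mem_univ _)))
        (norm_nonneg _) hM'.le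
    · apply le_of_eq
      have := Real.pi_pos
      field_simp

theorem slice_holo {n : ℕ} {P : Fin n → Set ℂ} {h : (Fin n → ℂ) → ℂ}
    (hh : DifferentiableOn ℂ h (pi univ P)) (j : Fin n) {z : Fin n → ℂ} (hz : z ∈ pi univ P) :
    DifferentiableOn ℂ (fun ζ => h (Function.update z j ζ)) (P j) :=
  hh.comp (differentiable_update_right j z).differentiableOn fun ζ hζ =>
    update_mem_pi (Z := P j) (by simpa using hz) hζ

theorem two_pi_norm : ‖(2 * Real.pi * Complex.I : ℂ)‖ = 2 * Real.pi := by
  simp [abs_of_pos Real.pi_pos]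

theorem disc_step {n : ℕ} {P : Fin n → Set ℂ} (hP : ∀ i, IsOpen (P i)) {h : (Fin n → ℂ) → ℂ}
    (hh : DifferentiableOn ℂ h (pi univ P)) (j : Fin n) {b' b : ℝ} (hb' : 0 ≤ b') (hb : b' < b)
    (hPj : P j = ball 0 b) {K : Fin n → Set ℂ}
    (hK : ∀ i, IsCompact (K i)) (hKP : ∀ i, K i ⊆ P i) (hKj : K j ⊆ closedBall 0 b')
    {ε : ℝ} (hε : 0 < ε) :
    ∃ H : (Fin n → ℂ) → ℂ, DifferentiableOn ℂ H (pi univ (Function.update P j univ)) ∧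
      (∀ z ∈ pi univ K, ‖h z - H z‖ ≤ ε) := by
  obtain ⟨r, hr1, hr2⟩ := exists_between hb
  have hr0 : 0 < r := hb'.trans_lt hr1
  have hKj' : ∀ w ∈ K j, ‖w‖ ≤ b' := fun w hw => by simpa using hKj hw
  have hker : KerApprox r univ (K j) := by
    intro δ hδ
    obtain ⟨κ, h1, h2, h3⟩ := ker_out hb' hr1 δ hδ
    exact ⟨κ, h1, h2, fun ζ hζ w hw => h3 ζ hζ w (hKj hw)⟩
  have hcb : closedBall (0:ℂ) r ⊆ P j := by rw [hPj]; exact closedBall_subset_ball hr2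
  obtain ⟨H, hH, hHe⟩ := ci_approx hP hh j hr0 (sphere_subset_closedBall.trans hcb)
    isOpen_univ hK hKP (fun w hw => ((hKj' w hw).trans_lt hr1).ne) hker
    (ε := 2 * Real.pi * ε) (by have := Real.pi_pos; positivity)
  refine ⟨fun z => (2 * Real.pi * Complex.I : ℂ)⁻¹ * H z, hH.const_mul _, ?_⟩
  intro z hz
  have hzP : z ∈ pi univ P := fun i hi => hKP i (hz i hi)
  have e := hHe z hz (mem_univ _)
  have hs := slice_holo hh j hzP
  have hc : (∮ ζ in C(0, r), h (Function.update z j ζ) * (ζ - z j)⁻¹)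
      = 2 * Real.pi * Complex.I * h z := by
    have := (hs.mono hcb).circleIntegral_sub_inv_smul (w := z j)
      (by simpa using (hKj' _ (hz j (mem_univ _))).trans_lt hr1)
    simp only [smul_eq_mul, Function.update_eq_self] at this
    rw [← this]
    congr 1; ext ζ; ring
  rw [hc] at e
  have h0 : (2 * Real.pi * Complex.I : ℂ) ≠ 0 := Complex.two_pi_I_ne_zero
  have e2 : h z - (2 * Real.pi * Complex.I : ℂ)⁻¹ * H z
      = (2 * Real.pi * Complex.I : ℂ)⁻¹ * (2 * Real.pi * Complex.I * h z - H z) := by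
    field_simp
  simp only
  rw [e2, norm_mul, norm_inv, two_pi_norm, inv_mul_le_iff₀ (by have := Real.pi_pos; positivity)]
  exact e

theorem ann_step {n : ℕ} {P : Fin n → Set ℂ} (hP : ∀ i, IsOpen (P i)) {h : (Fin n → ℂ) → ℂ}
    (hh : DifferentiableOn ℂ h (pi univ P)) (j : Fin n) {a a' b' b : ℝ} (ha : 0 < a)
    (ha' : a < a') (hb : b' < b) (hab : a' ≤ b')
    (hPj : P j = ball 0 b \ closedBall 0 a) {K : Fin n → Set ℂ}
    (hK : ∀ i, IsCompact (K i)) (hKP : ∀ i, K i ⊆ P i) (hKj : K j ⊆ closedBall 0 b' \ ball 0 a')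
    {ε : ℝ} (hε : 0 < ε) :
    ∃ H : (Fin n → ℂ) → ℂ, DifferentiableOn ℂ H (pi univ (Function.update P j {0}ᶜ)) ∧
      (∀ z ∈ pi univ K, ‖h z - H z‖ ≤ ε) := by
  obtain ⟨r, hr1, hr2⟩ := exists_between hb
  obtain ⟨s, hs1, hs2⟩ := exists_between ha'
  have hs0 : 0 < s := ha.trans hs1
  have hb'0 : 0 < b' := by linarith
  have hr0 : 0 < r := hb'0.trans hr1
  have hKj' : ∀ w ∈ K j, ‖w‖ ≤ b' ∧ a' ≤ ‖w‖ := fun w hw => by simpa using hKj hw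
  have hker : KerApprox r univ (K j) := by
    intro δ hδ
    obtain ⟨κ, h1, h2, h3⟩ := ker_out hb'0.le hr1 δ hδ
    exact ⟨κ, h1, h2, fun ζ hζ w hw => h3 ζ hζ w (hKj hw).1⟩
  have hker' : KerApprox s {0}ᶜ (K j) := by
    intro δ hδ
    obtain ⟨κ, h1, h2, h3⟩ := ker_in hs0 hs2 δ hδ
    exact ⟨κ, h1, h2, fun ζ hζ w hw => h3 ζ hζ w (hKj' w hw).2⟩
  have hcb : closedBall (0:ℂ) r \ ball 0 s ⊆ P j := by
    rw [hPj]
    intro w hw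
    simp at hw ⊢
    constructor <;> linarith
  have hsr : sphere (0:ℂ) r ⊆ P j := by
    refine Subset.trans ?_ hcb
    intro w hw
    simp at hw ⊢
    constructor <;> linarith
  have hss : sphere (0:ℂ) s ⊆ P j := by
    refine Subset.trans ?_ hcb
    intro w hw
    simp at hw ⊢
    constructor <;> linarith
  have hpi := Real.pi_pos
  obtain ⟨H₁, hH₁, hHe₁⟩ := ci_approx hP hh j hr0 hsr
    isOpen_univ hK hKP (fun w hw => ((hKj' w hw).1.trans_lt hr1).ne) hker
    (ε := Real.pi * ε) (by positivity)
  obtain ⟨H₂, hH₂, hHe₂⟩ := ci_approx hP hh j hs0 hss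
    isOpen_compl_singleton hK hKP (fun w hw => (hs2.trans_le (hKj' w hw).2).ne') hker'
    (ε := Real.pi * ε) (by positivity)
  refine ⟨fun z => (2 * Real.pi * Complex.I : ℂ)⁻¹ * (H₁ z - H₂ z),
    DifferentiableOn.const_mul ((hH₁.mono ?_).sub hH₂) _, ?_⟩
  · refine pi_mono fun i _ => ?_
    by_cases hi : i = j
    · subst hi; simp
    · simp [Function.update_of_ne hi]
  intro z hz
  have hzP : z ∈ pi univ P := fun i hi => hKP i (hz i hi)
  have hzj := hKj' _ (hz j (mem_univ _))
  have e1 := hHe₁ z hz (mem_univ _)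
  have e2 := hHe₂ z hz (by
    intro h
    have : z j = 0 := h
    rw [this] at hzj; simp at hzj; linarith)
  have hs := slice_holo hh j hzP
  have hc := annulus_cauchy hs0 (hs2.trans_le hzj.2) (hzj.1.trans_lt hr1) (hP j) hcb hs
  simp only [Function.update_eq_self] at hc
  have h0 : (2 * Real.pi * Complex.I : ℂ) ≠ 0 := Complex.two_pi_I_ne_zero
  have e3 : h z - (2 * Real.pi * Complex.I : ℂ)⁻¹ * (H₁ z - H₂ z)
      = (2 * Real.pi * Complex.I : ℂ)⁻¹ * (2 * Real.pi * Complex.I * h z - (H₁ z - H₂ z)) := by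
    field_simp
  simp only
  rw [e3, norm_mul, norm_inv, two_pi_norm, inv_mul_le_iff₀ (by positivity), ← hc]
  refine le_trans (le_trans (le_of_eq ?_) (norm_sub_le _ _)) ((add_le_add e1 e2).trans (by linarith))
  congr 1
  ring

end PPD

namespace PPD
open Filter Topology MeasureTheory

/-- open polyannulus -/
def OO (k : ℕ) (a b : ℝ) : Set (Fin (k+1) → ℂ) := {z | (∀ j, ‖z j‖ < b) ∧ a < ‖z 0‖}

theorem isOpen_OO {k : ℕ} {a b : ℝ} : IsOpen (OO k a b) := by
  have h1 : IsOpen {z : Fin (k+1) → ℂ | ∀ j, ‖z j‖ < b} := by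
    simp only [ofPred_forall]
    exact isOpen_iInter_of_finite fun j => isOpen_lt (by fun_prop) continuous_const
  have h2 : IsOpen {z : Fin (k+1) → ℂ | a < ‖z 0‖} := isOpen_lt continuous_const (by fun_prop)
  exact h1.inter h2

theorem approx {k : ℕ} {a a' b' b : ℝ} (ha : 0 < a) (ha' : a < a') (hab : a' ≤ b') (hb : b' < b)
    {h : (Fin (k+1) → ℂ) → ℂ} (hh : DifferentiableOn ℂ h (OO k a b)) {ε : ℝ} (hε : 0 < ε) :
    ∃ H : (Fin (k+1) → ℂ) → ℂ, DifferentiableOn ℂ H {z | z 0 ≠ 0} ∧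
      ∀ z ∈ KK k a' b', ‖h z - H z‖ ≤ ε := by
  classical
  set P : Finset (Fin (k+1)) → Fin (k+1) → Set ℂ := fun s i =>
    if i = 0 then (if i ∈ s then {0}ᶜ else ball 0 b \ closedBall 0 a)
      else if i ∈ s then univ else ball 0 b with hPd
  set K : Fin (k+1) → Set ℂ := fun i => if i = 0 then closedBall 0 b' \ ball 0 a' else closedBall 0 b'
    with hKd
  have hKc : ∀ i, IsCompact (K i) := by
    intro i
    by_cases hi : i = 0
    · simp only [hKd, hi, if_true]; exact (isCompact_closedBall _ _).diff isOpen_ball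
    · simp only [hKd, hi, if_false]; exact isCompact_closedBall _ _
  have hPo : ∀ s i, IsOpen (P s i) := by
    intro s i
    simp only [hPd]
    split_ifs
    · exact isOpen_compl_singleton
    · exact isOpen_ball.sdiff isClosed_closedBall
    · exact isOpen_univ
    · exact isOpen_ball
  have hKP : ∀ s i, K i ⊆ P s i := by
    intro s i w hw
    simp only [hPd]
    simp only [hKd] at hw
    split_ifs at hw ⊢
    · simp at hw ⊢
      rintro rfl
      simp at hw; linarith
    · simp at hw ⊢
      constructor <;> linarith
    · exact mem_univ _
    · simp at hw ⊢; linarith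
  have hup : ∀ s j, P (insert j s) = Function.update (P s) j (if j = 0 then {0}ᶜ else univ) := by
    intro s j
    ext1 i
    by_cases hi : i = j
    · subst hi
      rw [Function.update_self]
      simp [hPd]
    · rw [Function.update_of_ne hi]
      simp [hPd, hi]
  have key : ∀ s : Finset (Fin (k+1)), ∀ ε > 0, ∃ H : (Fin (k+1) → ℂ) → ℂ,
      DifferentiableOn ℂ H (pi univ (P s)) ∧ ∀ z ∈ pi univ K, ‖h z - H z‖ ≤ ε := by
    intro s
    induction s using Finset.induction_on with
    | empty =>
      intro ε hε
      refine ⟨h, hh.mono ?_, fun z _ => by simp [hε.le]⟩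
      intro z hz
      have h0 := hz 0 (mem_univ _)
      simp [hPd] at h0
      refine ⟨fun j => ?_, h0.2⟩
      by_cases hj : j = 0
      · rw [hj]; exact h0.1
      · have := hz j (mem_univ _)
        simpa [hPd, hj] using this
    | insert j s hj ih =>
      intro ε hε
      obtain ⟨H, hH, hHe⟩ := ih (ε / 2) (half_pos hε)
      obtain ⟨H', hH', hHe'⟩ : ∃ H' : (Fin (k+1) → ℂ) → ℂ,
          DifferentiableOn ℂ H' (pi univ (P (insert j s))) ∧ ∀ z ∈ pi univ K, ‖H z - H' z‖ ≤ ε / 2 := by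
        rw [hup]
        by_cases hj0 : j = 0
        · subst hj0
          rw [if_pos rfl]
          exact ann_step (hPo s) hH 0 ha ha' hb hab (by simp [hPd, hj]) hKc (hKP s) (by simp [hKd])
            (half_pos hε)
        · rw [if_neg hj0]
          exact disc_step (hPo s) hH j (b' := b') (by linarith) hb (by simp [hPd, hj, hj0]) hKc (hKP s)
            (by simp [hKd, hj0]) (half_pos hε)
      refine ⟨H', hH', fun z hz => ?_⟩
      have := norm_add_le (h z - H z) (H z - H' z)
      rw [sub_add_sub_cancel] at this
      linarith [hHe z hz, hHe' z hz]
  obtain ⟨H, hH, hHe⟩ := key Finset.univ ε hε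
  refine ⟨H, hH.mono ?_, fun z hz => hHe z ?_⟩
  · intro z hz i _
    by_cases hi : i = 0
    · subst hi; simpa [hPd] using hz
    · simp [hPd, hi]
  · intro i _
    by_cases hi : i = 0
    · subst hi; simp [hKd, hz.1 0, hz.2]
    · simp [hKd, hi, hz.1 i]

theorem unit_form {k : ℕ} {a b : ℝ} (ha : 0 < a) (hab : a < b)
    {f : (Fin (k+1) → ℂ) → ℂ} (hf : DifferentiableOn ℂ f (OO k a b)) (hf0 : ∀ z ∈ OO k a b, f z ≠ 0) :
    ∃ (m : ℤ) (h : (Fin (k+1) → ℂ) → ℂ), DifferentiableOn ℂ h (OO k a b) ∧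
      ∀ z ∈ OO k a b, f z = z 0 ^ m * Complex.exp (h z) := by
  classical
  set V : Set (Fin (k+1) → ℂ) := pi univ (fun j => if j = 0 then Complex.re ⁻¹' Ioo (Real.log a) (Real.log b)
    else ball 0 b) with hV
  have hVo : IsOpen V := by
    refine isOpen_set_pi finite_univ fun j _ => ?_
    split_ifs
    · exact isOpen_Ioo.preimage Complex.continuous_re
    · exact isOpen_ball
  have hVc : Convex ℝ V := by
    refine convex_pi fun j _ => ?_
    split_ifs
    · exact (convex_Ioo _ _).linear_preimage Complex.reCLM.toLinearMap
    · exact convex_ball _ _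
  set p : (Fin (k+1) → ℂ) → (Fin (k+1) → ℂ) := fun w => Function.update w 0 (Complex.exp (w 0)) with hp
  have hp0 : ∀ w, p w 0 = Complex.exp (w 0) := fun w => by simp [hp]
  have hpj : ∀ w j, j ≠ 0 → p w j = w j := fun w j hj => by simp [hp, hj]
  have hVp : ∀ w, w ∈ V ↔ p w ∈ OO k a b := by
    intro w
    have e0 : w 0 ∈ Complex.re ⁻¹' Ioo (Real.log a) (Real.log b) ↔ a < ‖p w 0‖ ∧ ‖p w 0‖ < b := by
      rw [hp0, Complex.norm_exp, mem_preimage, mem_Ioo, Real.log_lt_iff_lt_exp ha,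
        Real.lt_log_iff_exp_lt (ha.trans hab)]
    constructor
    · intro hw
      have h0 := hw 0 (mem_univ _)
      simp only [if_true] at h0
      rw [e0] at h0
      refine ⟨fun j => ?_, h0.1⟩
      by_cases hj : j = 0
      · subst hj; exact h0.2
      · have := hw j (mem_univ _)
        simp only [hj, if_false] at this
        rw [hpj w j hj]; simpa using this
    · rintro ⟨h1, h2⟩ j -
      by_cases hj : j = 0
      · subst hj; simp only [if_true]; rw [e0]; exact ⟨h2, h1 0⟩
      · simp only [hj, if_false]
        have := h1 j
        rw [hpj w j hj] at this; simpa using this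
  have hpd : Differentiable ℂ p := by
    rw [differentiable_pi]
    intro i
    by_cases hi : i = 0
    · subst hi; simp only [hp0]; fun_prop
    · simp only [hpj _ _ hi]; fun_prop
  obtain ⟨H, hH, hfH⟩ := exists_log hVo hVc
    (hf.comp hpd.differentiableOn fun w hw => (hVp w).1 hw) (fun w hw => hf0 _ ((hVp w).1 hw))
  simp only [Function.comp] at hfH
  set T : (Fin (k+1) → ℂ) := Pi.single 0 (2 * Real.pi * Complex.I) with hT
  have hpT : ∀ w, p (w + T) = p w := by
    intro w
    ext i
    by_cases hi : i = 0
    · subst hi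
      rw [hp0, hp0, Pi.add_apply, hT, Pi.single_eq_same, Complex.exp_periodic]
    · rw [hpj _ _ hi, hpj _ _ hi, Pi.add_apply, hT, Pi.single_eq_of_ne hi, add_zero]
  have hVT : ∀ w, w ∈ V → w + T ∈ V := fun w hw => by rwa [hVp, hpT, ← hVp]
  have hVT' : ∀ w, w ∈ V → w - T ∈ V := fun w hw => by rwa [hVp, ← hpT, sub_add_cancel, ← hVp]
  have hintg : ∀ w, ∃ n : ℤ, w ∈ V → H (w + T) = H w + n * (2 * Real.pi * Complex.I) := by
    intro w
    by_cases hw : w ∈ V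
    · have e1 := hfH w hw
      have e2 := hfH (w + T) (hVT w hw)
      rw [hpT, e1] at e2
      obtain ⟨n, hn⟩ := Complex.exp_eq_exp_iff_exists_int.1 e2.symm
      exact ⟨n, fun _ => hn⟩
    · exact ⟨0, fun h => absurd h hw⟩
  choose N hN using hintg
  have h2pi : (2 * Real.pi * Complex.I : ℂ) ≠ 0 := Complex.two_pi_I_ne_zero
  have hNc : ContinuousOn N V := by
    rw [Int.isClosedEmbedding_coe_real.isInducing.continuousOn_iff]
    have : ContinuousOn (fun w => ((H (w + T) - H w) / (2 * Real.pi * Complex.I)).re) V := by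
      refine Complex.continuous_re.comp_continuousOn (ContinuousOn.div_const (ContinuousOn.sub ?_ hH.continuousOn) _)
      exact hH.continuousOn.comp (by fun_prop) fun w hw => hVT w hw
    refine this.congr fun w hw => ?_
    simp only [Function.comp]
    rw [hN w hw, add_sub_cancel_left, mul_div_cancel_right₀ _ h2pi]
    simp
  obtain ⟨m, hm⟩ : ∃ m : ℤ, ∀ w ∈ V, N w = m := by
    rcases V.eq_empty_or_nonempty with h | ⟨w0, hw0⟩
    · exact ⟨0, by simp [h]⟩
    · exact ⟨N w0, fun w hw => hVc.isPreconnected.constant hNc hw hw0⟩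
  set G : (Fin (k+1) → ℂ) → ℂ := fun w => H w - m * w 0 with hG
  have hGd : DifferentiableOn ℂ G V := hH.sub (by fun_prop)
  have hGT : ∀ w ∈ V, G (w + T) = G w := by
    intro w hw
    simp only [hG]
    rw [hN w hw, hm w hw, Pi.add_apply, hT, Pi.single_eq_same]
    ring
  have hGn : ∀ (n : ℤ) (w), w ∈ V → w + n • T ∈ V ∧ G (w + n • T) = G w := by
    intro n w hw
    induction n using Int.induction_on with
    | zero => simpa using hw
    | succ n ih =>
      have e : w + ((n:ℤ) + 1) • T = (w + (n:ℤ) • T) + T := by rw [add_smul, one_smul, add_assoc]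
      rw [e]
      exact ⟨hVT _ ih.1, by rw [hGT _ ih.1, ih.2]⟩
    | pred n ih =>
      have e : w + (-(n:ℤ) - 1) • T = (w + (-(n:ℤ)) • T) - T := by
        rw [sub_smul, one_smul, add_sub_assoc]
      rw [e]
      refine ⟨hVT' _ ih.1, ?_⟩
      rw [← ih.2, ← hGT _ (hVT' _ ih.1), sub_add_cancel]
  have hGp : ∀ w w', w' ∈ V → p w = p w' → G w = G w' := by
    intro w w' hw' he
    have e0 : Complex.exp (w 0) = Complex.exp (w' 0) := by rw [← hp0, ← hp0, he]
    obtain ⟨n, hn⟩ := Complex.exp_eq_exp_iff_exists_int.1 e0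
    have : w = w' + n • T := by
      ext i
      by_cases hi : i = 0
      · subst hi
        rw [hn, Pi.add_apply, Pi.smul_apply, hT, Pi.single_eq_same, zsmul_eq_mul]
      · have := congrFun he i
        rw [hpj _ _ hi, hpj _ _ hi] at this
        rw [this, Pi.add_apply, Pi.smul_apply, hT, Pi.single_eq_of_ne hi, smul_zero, add_zero]
    rw [this]
    exact (hGn n w' hw').2
  have hpu : ∀ (z : (Fin (k+1) → ℂ)) (c : ℂ), Complex.exp c = z 0 → p (Function.update z 0 c) = z := by
    intro z c hc
    simp [hp, hc]
  have hz0 : ∀ z ∈ OO k a b, z 0 ≠ 0 := by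
    intro z hz h
    have := hz.2
    rw [h, norm_zero] at this
    linarith
  refine ⟨m, fun z => G (Function.update z 0 (Complex.log (z 0))), ?_, ?_⟩
  · have hloc : ∀ (L : ℂ → ℂ) (D : Set ℂ), IsOpen D → DifferentiableOn ℂ L D →
        (∀ ζ ∈ D, ζ ≠ 0 → Complex.exp (L ζ) = ζ) → ∀ z ∈ OO k a b, z 0 ∈ D →
        DifferentiableAt ℂ (fun z : (Fin (k+1) → ℂ) => G (Function.update z 0 (Complex.log (z 0)))) z := by
      intro L D hD hL hLe z hz hzD
      have hopen : IsOpen (OO k a b ∩ {z | z 0 ∈ D}) := isOpen_OO.inter (hD.preimage (continuous_apply 0))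
      have hmem : ∀ y ∈ OO k a b ∩ {z | z 0 ∈ D}, Function.update y 0 (L (y 0)) ∈ V := by
        rintro y ⟨hy, hyD⟩
        rw [hVp, hpu y _ (hLe _ hyD (hz0 y hy))]; exact hy
      have h1 : DifferentiableOn ℂ (fun z : (Fin (k+1) → ℂ) => G (Function.update z 0 (L (z 0)))) (OO k a b ∩ {z | z 0 ∈ D}) := by
        refine hGd.comp ?_ hmem
        rw [differentiableOn_pi]
        intro i
        by_cases hi : i = 0
        · subst hi
          simp only [Function.update_self]
          exact hL.comp (by fun_prop) fun y hy => hy.2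
        · simp only [Function.update_of_ne hi]; fun_prop
      refine DifferentiableOn.differentiableAt (h1.congr fun y hy => ?_) (hopen.mem_nhds ⟨hz, hzD⟩)
      apply hGp _ _ (hmem y hy)
      rw [hpu y _ (hLe _ hy.2 (hz0 y hy.1)), hpu y _ (Complex.exp_log (hz0 y hy.1))]
    intro z hz
    apply DifferentiableAt.differentiableWithinAt
    by_cases hs : z 0 ∈ Complex.slitPlane
    · exact hloc Complex.log Complex.slitPlane Complex.isOpen_slitPlane
        (fun ζ hζ => (Complex.differentiableAt_log hζ).differentiableWithinAt)
        (fun ζ _ h => Complex.exp_log h) z hz hs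
    · refine hloc (fun ζ => Complex.log (-ζ) + Real.pi * Complex.I) {ζ | -ζ ∈ Complex.slitPlane}
        (Complex.isOpen_slitPlane.preimage continuous_neg) ?_ ?_ z hz ?_
      · intro ζ hζ
        exact ((DifferentiableAt.clog differentiableAt_id.neg hζ).add_const _).differentiableWithinAt
      · intro ζ _ h
        rw [Complex.exp_add, Complex.exp_log (neg_ne_zero.2 h), Complex.exp_pi_mul_I]
        ring
      · show -z 0 ∈ Complex.slitPlane
        have := Complex.mem_slitPlane_or_neg_mem_slitPlane (hz0 z hz)
        exact this.resolve_left hs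
  · intro z hz
    have hw : Function.update z 0 (Complex.log (z 0)) ∈ V := by
      rw [hVp, hpu z _ (Complex.exp_log (hz0 z hz))]; exact hz
    have := hfH _ hw
    rw [hpu z _ (Complex.exp_log (hz0 z hz))] at this
    rw [this]
    simp only [hG, Function.update_self]
    rw [Complex.exp_sub, Complex.exp_int_mul, Complex.exp_log (hz0 z hz),
      mul_div_cancel₀ _ (zpow_ne_zero _ (hz0 z hz))]

/-- Runge approximation for units -/
theorem runge_unit {k : ℕ} {a a' b' b : ℝ} (ha : 0 < a) (ha' : a < a') (hab : a' ≤ b') (hb : b' < b)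
    {f : (Fin (k+1) → ℂ) → ℂ} (hf : DifferentiableOn ℂ f (OO k a b)) (hf0 : ∀ z ∈ OO k a b, f z ≠ 0)
    {ε : ℝ} (hε : 0 < ε) :
    ∃ e u : (Fin (k+1) → ℂ) → ℂ, DifferentiableOn ℂ e {z | z 0 ≠ 0} ∧ (∀ z, z 0 ≠ 0 → e z ≠ 0) ∧
      DifferentiableOn ℂ u (OO k a b) ∧ (∀ z ∈ KK k a' b', ‖u z‖ ≤ ε) ∧
      ∀ z ∈ OO k a b, f z = e z * Complex.exp (u z) := by
  obtain ⟨m, h, hh, hfh⟩ := unit_form ha (by linarith) hf hf0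
  obtain ⟨H, hH, hHe⟩ := approx ha ha' hab hb hh hε
  have hsub : OO k a b ⊆ {z | z 0 ≠ 0} := by
    intro z hz h
    have := hz.2
    rw [h, norm_zero] at this
    linarith
  refine ⟨fun z => z 0 ^ m * Complex.exp (H z), fun z => h z - H z, ?_, ?_, ?_, hHe, ?_⟩
  · refine DifferentiableOn.fun_mul ?_ hH.cexp
    have : DifferentiableOn ℂ (fun ζ : ℂ => ζ ^ m) {0}ᶜ := fun ζ hζ =>
      (differentiableAt_zpow.2 (Or.inl hζ)).differentiableWithinAt
    exact this.comp (t := {0}ᶜ) (f := fun z : Fin (k+1) → ℂ => z 0) (by fun_prop) (fun z hz => hz)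
  · intro z hz
    exact mul_ne_zero (zpow_ne_zero _ hz) (Complex.exp_ne_zero _)
  · exact hh.sub (hH.mono hsub)
  · intro z hz
    rw [hfh z hz, mul_assoc, ← Complex.exp_add, add_sub_cancel]

end PPD

namespace PPD
open Filter Topology MeasureTheory

theorem holo_tsum {n : ℕ} {V : Set (Fin n → ℂ)} (hV : IsOpen V) {u : ℕ → (Fin n → ℂ) → ℂ} {c : ℕ → ℝ}
    (hc : Summable c) (hu : ∀ m, DifferentiableOn ℂ (u m) V) (hb : ∀ m, ∀ z ∈ V, ‖u m z‖ ≤ c m) :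
    DifferentiableOn ℂ (fun z => ∑' m, u m z) V := by
  rcases V.eq_empty_or_nonempty with rfl | ⟨z0, hz0⟩
  · exact differentiableOn_empty
  have hc0 : ∀ m, 0 ≤ c m := fun m => (norm_nonneg _).trans (hb m z0 hz0)
  have hci : Integrable c Measure.count := by
    rw [integrable_count_iff]; exact hc.abs
  have := holo_integral (μ := Measure.count) (F := u) hV (Eventually.of_forall hu)
    (fun x _ => (measurable_of_countable _).aestronglyMeasurable)
    (Eventually.of_forall hb) hci
  refine this.congr fun z hz => ?_
  have hi : Integrable (fun m => u m z) Measure.count := by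
    rw [integrable_count_iff]
    exact Summable.of_nonneg_of_le (fun m => norm_nonneg _) (fun m => hb m z hz) hc
  rw [integral_countable hi]
  simp

theorem TrivOn.smul {n : ℕ} {ι : Type} {U : ι → Set (Fin n → ℂ)} {g : ι → ι → (Fin n → ℂ) → ℂ}
    {W : Set (Fin n → ℂ)} {φ : ι → (Fin n → ℂ) → ℂ} (h : TrivOn U g W φ) {f : (Fin n → ℂ) → ℂ}
    (hf : DifferentiableOn ℂ f W) (hf0 : ∀ z ∈ W, f z ≠ 0) :
    TrivOn U g W (fun i z => φ i z * f z) :=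
  ⟨fun i => (h.hol i).mul (hf.mono inter_subset_right),
    fun i z hz => mul_ne_zero (h.ne i z hz) (hf0 z hz.2),
    fun i j z hz => by rw [h.eq i j z hz, mul_assoc]⟩

theorem triv_all {k : ℕ} {ι : Type} {U : ι → Set (Fin (k+1) → ℂ)}
    {g : ι → ι → (Fin (k+1) → ℂ) → ℂ} (hc : Coc U g)
    (hU : {z : Fin (k + 1) → ℂ | (∀ j, z j ∈ ball (0 : ℂ) 1) ∧ z 0 ≠ 0} ⊆ ⋃ i, U i) :
    ∃ φ, TrivOn U g {z : Fin (k + 1) → ℂ | (∀ j, z j ∈ ball (0 : ℂ) 1) ∧ z 0 ≠ 0} φ := by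
  classical
  set X := {z : Fin (k + 1) → ℂ | (∀ j, z j ∈ ball (0 : ℂ) 1) ∧ z 0 ≠ 0} with hX
  set a : ℕ → ℝ := fun n => 1 / ((n:ℝ) + 3) with had
  set b : ℕ → ℝ := fun n => 1 - 1 / ((n:ℝ) + 3) with hbd
  have ha0 : ∀ n, 0 < a n := fun n => by positivity
  have hb1 : ∀ n, b n < 1 := fun n => by have := ha0 n; simp only [had, hbd] at *; linarith
  have haa : ∀ n, a (n+1) < a n := by
    intro n
    simp only [had]
    apply one_div_lt_one_div_of_lt (by positivity)
    push_cast; linarith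
  have hba : ∀ n, b n = 1 - a n := fun n => rfl
  have hbb : ∀ n, b n < b (n+1) := fun n => by rw [hba, hba]; linarith [haa n]
  have hab : ∀ n, a n ≤ b n := by
    intro n
    have : a n ≤ 1 / 2 := by
      apply one_div_le_one_div_of_le (by norm_num)
      have : (0:ℝ) ≤ n := Nat.cast_nonneg n
      linarith
    rw [hba]; linarith
  set O : ℕ → Set (Fin (k+1) → ℂ) := fun n => OO k (a n) (b n) with hO
  have hOo : ∀ n, IsOpen (O n) := fun n => isOpen_OO
  have hOK : ∀ n, O n ⊆ KK k (a n) (b n) := fun n z hz => ⟨fun j => (hz.1 j).le, hz.2.le⟩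
  have hKX : ∀ n, KK k (a n) (b n) ⊆ X := by
    rintro n z ⟨h1, h2⟩
    refine ⟨fun j => by simpa using (h1 j).trans_lt (hb1 n), fun h => ?_⟩
    rw [h, norm_zero] at h2
    linarith [ha0 n]
  have hOX : ∀ n, O n ⊆ X := fun n => (hOK n).trans (hKX n)
  have hOs : ∀ n, O n ⊆ O (n+1) := fun n z hz =>
    ⟨fun j => (hz.1 j).trans (hbb n), (haa n).trans hz.2⟩
  have hOm : Monotone O := monotone_nat_of_le_succ hOs
  have hOne : ∀ n, O n ⊆ {z | z 0 ≠ 0} := fun n z hz => (hOX n hz).2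
  have hXO : ∀ z ∈ X, ∃ n, z ∈ O n := by
    rintro z ⟨h1, h2⟩
    have ht : Tendsto a atTop (𝓝 0) :=
      ((tendsto_natCast_atTop_atTop (R := ℝ)).atTop_add tendsto_const_nhds).const_div_atTop 1
    have e1 : ∀ᶠ n in atTop, a n < ‖z 0‖ := ht.eventually_lt_const (norm_pos_iff.2 h2)
    have e2 : ∀ᶠ n in atTop, ∀ j, a n < 1 - ‖z j‖ := by
      rw [eventually_all]
      intro j
      refine ht.eventually_lt_const ?_
      have := h1 j
      simp at this; linarith
    obtain ⟨n, h3, h4⟩ := (e1.and e2).exists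
    exact ⟨n, fun j => by rw [hba]; linarith [h4 j], h3⟩
  have hT : ∀ n, ∃ φ, TrivOn U g (O n) φ := by
    intro n
    obtain ⟨W, φ, -, h1, -, h2⟩ := trivNear_KK hc (ha0 n) ((hKX n).trans hU)
    exact ⟨φ, h2.mono ((hOK n).trans h1)⟩
  choose φ hφ using hT
  have hR : ∀ n, ∃ e u : (Fin (k+1) → ℂ) → ℂ, DifferentiableOn ℂ e {z | z 0 ≠ 0} ∧
      (∀ z, z 0 ≠ 0 → e z ≠ 0) ∧ DifferentiableOn ℂ u (O (n+1)) ∧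
      (∀ z ∈ O n, ‖u z‖ ≤ (1/2:ℝ) ^ n) ∧
      ∀ i, ∀ z ∈ U i ∩ O (n+1), φ (n+2) i z = e z * Complex.exp (u z) * φ (n+1) i z := by
    intro n
    obtain ⟨f, hf, hf0, hfe⟩ := TrivOn.ratio hc (hOo (n+1)) ((hOX _).trans hU)
      ((hφ (n+2)).mono (hOs (n+1))) (hφ (n+1))
    obtain ⟨e, u, he, he0, hu, hub, hfu⟩ := runge_unit (ha0 (n+1)) (haa n) (hab n) (hbb n) hf hf0
      (ε := (1/2:ℝ)^n) (by positivity)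
    refine ⟨e, u, he, he0, hu, fun z hz => hub z (hOK n hz), fun i z hz => ?_⟩
    rw [hfe i z hz, hfu z hz.2]
  choose e u he he0 hu hub hfu using hR
  set c : ℕ → (Fin (k+1) → ℂ) → ℂ := fun n z => ∏ l ∈ Finset.range n, e l z with hcd
  have hcs : ∀ n z, c (n+1) z = c n z * e n z := fun n z => Finset.prod_range_succ _ _
  have hc0 : ∀ n z, z 0 ≠ 0 → c n z ≠ 0 := fun n z hz =>
    Finset.prod_ne_zero_iff.2 fun l _ => he0 l z hz
  have hcD : ∀ n, DifferentiableOn ℂ (c n) {z | z 0 ≠ 0} := by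
    intro n
    induction n with
    | zero => simp [hcd]
    | succ n ih => exact (ih.fun_mul (he n)).congr fun z _ => hcs n z
  set S : ℕ → (Fin (k+1) → ℂ) → ℂ := fun n z => ∑' m, u (n + m) z with hSd
  have hsum : ∀ n : ℕ, Summable (fun m : ℕ => (1/2:ℝ) ^ (n + m)) := by
    intro n
    simp only [pow_add]
    exact (summable_geometric_of_lt_one (by norm_num) (by norm_num)).mul_left _
  have hbnd : ∀ n m, ∀ z ∈ O n, ‖u (n + m) z‖ ≤ (1/2:ℝ) ^ (n + m) := fun n m z hz =>
    hub (n + m) z (hOm (Nat.le_add_right n m) hz)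
  have hSD : ∀ n, DifferentiableOn ℂ (S n) (O n) := by
    intro n
    exact holo_tsum (hOo n) (hsum n)
      (fun m => (hu (n + m)).mono (hOm (by omega))) (hbnd n)
  have hSs : ∀ n, ∀ z ∈ O n, S n z = u n z + S (n+1) z := by
    intro n z hz
    have hs : Summable (fun m => u (n + m) z) :=
      Summable.of_norm_bounded (hsum n) fun m => hbnd n m z hz
    simp only [hSd]
    rw [hs.tsum_eq_zero_add]
    simp only [add_zero]
    congr 1
    refine tsum_congr fun m => ?_
    rw [show n + (m + 1) = n + 1 + m by omega]
  set ψ : ℕ → ι → (Fin (k+1) → ℂ) → ℂ := fun n i z =>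
    φ (n+1) i z * ((c n z)⁻¹ * Complex.exp (S n z)) with hψ
  have hψT : ∀ n, TrivOn U g (O n) (ψ n) := by
    intro n
    refine ((hφ (n+1)).mono (hOs n)).smul ?_ ?_
    · exact DifferentiableOn.fun_mul (((hcD n).mono (hOne n)).fun_inv fun z hz => hc0 n z (hOne n hz))
        (hSD n).cexp
    · intro z hz
      exact mul_ne_zero (inv_ne_zero (hc0 n z (hOne n hz))) (Complex.exp_ne_zero _)
  have hψs : ∀ n i, ∀ z ∈ U i ∩ O n, ψ (n+1) i z = ψ n i z := by
    rintro n i z ⟨hi, hz⟩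
    have h0 := hOne n hz
    have h1 := hc0 n z h0
    have h2 := he0 n z h0
    simp only [hψ]
    rw [hfu n i z ⟨hi, hOs n hz⟩, hSs n z hz, hcs, Complex.exp_add]
    field_simp
  have hψm : ∀ n m i, n ≤ m → ∀ z ∈ U i ∩ O n, ψ m i z = ψ n i z := by
    intro n m i hnm z hz
    induction m, hnm using Nat.le_induction with
    | base => rfl
    | succ m hm ih => rw [hψs m i z ⟨hz.1, hOm hm hz.2⟩, ih]
  have hex : ∀ z, ∃ n, z ∈ X → z ∈ O n := by
    intro z
    by_cases hz : z ∈ X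
    · obtain ⟨n, hn⟩ := hXO z hz
      exact ⟨n, fun _ => hn⟩
    · exact ⟨0, fun h => absurd h hz⟩
  choose N hN using hex
  have hfin : ∀ n i, ∀ z ∈ U i ∩ O n, ψ (N z) i z = ψ n i z := by
    rintro n i z ⟨hi, hz⟩
    have hz' := hN z (hOX n hz)
    rcases le_total n (N z) with h | h
    · exact hψm n _ i h z ⟨hi, hz⟩
    · exact (hψm _ n i h z ⟨hi, hz'⟩).symm
  refine ⟨fun i z => ψ (N z) i z, ?_, ?_, ?_⟩
  · rintro i z ⟨hi, hz⟩
    have hz' := hN z hz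
    have : DifferentiableOn ℂ (fun z => ψ (N z) i z) (U i ∩ O (N z)) :=
      ((hψT (N z)).hol i).congr fun y hy => hfin _ i y hy
    exact (this.differentiableAt (((hc.op i).inter (hOo _)).mem_nhds ⟨hi, hz'⟩)).differentiableWithinAt
  · rintro i z ⟨hi, hz⟩
    exact (hψT (N z)).ne i z ⟨hi, hN z hz⟩
  · rintro i j z ⟨hi, hz⟩
    exact (hψT (N z)).eq i j z ⟨hi, hN z hz⟩

end PPD

/-- Every holomorphic line bundle on `Δ* × Δᵏ` is holomorphically trivial, formulated in
terms of cocycles: any holomorphic nowhere-vanishing cocycle on an open cover of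
`Δ* × Δᵏ` is a holomorphic coboundary. -/
theorem line_bundle_on_punctured_polydisk_trivial (k : ℕ) (ι : Type)
    (U : ι → Set (Fin (k + 1) → ℂ))
    (hUopen : ∀ i, IsOpen (U i))
    (hUsub : ∀ i, U i ⊆ {z : Fin (k + 1) → ℂ | (∀ j, z j ∈ ball (0 : ℂ) 1) ∧ z 0 ≠ 0})
    (hcover : {z : Fin (k + 1) → ℂ | (∀ j, z j ∈ ball (0 : ℂ) 1) ∧ z 0 ≠ 0} ⊆ ⋃ i, U i)
    (g : ι → ι → (Fin (k + 1) → ℂ) → ℂ)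
    (hghol : ∀ i j, DifferentiableOn ℂ (g i j) (U i ∩ U j))
    (hg0 : ∀ i j, ∀ z ∈ U i ∩ U j, g i j z ≠ 0)
    (hcoc : ∀ i j l, ∀ z ∈ U i ∩ U j ∩ U l, g i j z * g j l z = g i l z) :
    ∃ φ : ι → (Fin (k + 1) → ℂ) → ℂ,
      (∀ i, DifferentiableOn ℂ (φ i) (U i)) ∧
      (∀ i, ∀ z ∈ U i, φ i z ≠ 0) ∧
      ∀ i j, ∀ z ∈ U i ∩ U j, g i j z = φ i z * (φ j z)⁻¹ := by
  obtain ⟨φ, hφ⟩ := PPD.triv_all (U := U) (g := g) ⟨hUopen, hghol, hg0, hcoc⟩ hcover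
  refine ⟨φ, fun i => (hφ.hol i).mono fun z hz => ⟨hz, hUsub i hz⟩,
    fun i z hz => hφ.ne i z ⟨hz, hUsub i hz⟩, fun i j z hz => ?_⟩
  rw [hφ.eq i j z ⟨hz, hUsub i hz.1⟩, mul_assoc,
    mul_inv_cancel₀ (hφ.ne j z ⟨hz.2, hUsub j hz.2⟩), mul_one]
end

section
/- Let h : Δ* → ℝ_{>0} be such that log h is harmonic on Δ*. Then there exist a unique γ ∈ [0,2), an integer k, and a holomorphic function f on Δ* such that, writing β = γ + 2k, one has log h(z) + β log|z| = 2Re f(z) on Δ*, and consequently, with φ(z) = z^{−k} e^{f(z)}, h·|z^{−k}e^{f}|^{−2} = |z|^{−γ} on Δ*. -/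
open Metric Set

/-- `u : ℂ → ℝ` is harmonic on `s`. -/
def HarmonicOnC (u : ℂ → ℝ) (s : Set ℂ) : Prop :=
  ContDiffOn ℝ 2 u s ∧ ∀ z ∈ s,
    fderiv ℝ (fun w => fderiv ℝ u w 1) z 1 +
      fderiv ℝ (fun w => fderiv ℝ u w Complex.I) z Complex.I = 0

namespace FlatWeight

/-- The left half plane, the universal cover of the punctured disk via `exp`. -/
def S : Set ℂ := {w | w.re < 0}

lemma isOpen_S : IsOpen S := isOpen_lt Complex.continuous_re continuous_const

lemma convex_S : Convex ℝ S := convex_halfSpace_re_lt 0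

lemma exp_mem {w : ℂ} (hw : w ∈ S) : Complex.exp w ∈ ball (0 : ℂ) 1 \ {0} := by
  refine ⟨?_, by simp⟩
  rw [mem_ball_zero_iff, Complex.norm_exp]
  exact (Real.exp_lt_exp.2 hw).trans_eq Real.exp_zero

lemma log_mem {z : ℂ} (hz : z ∈ ball (0 : ℂ) 1 \ {0}) : Complex.log z ∈ S := by
  have h1 : ‖z‖ < 1 := mem_ball_zero_iff.1 hz.1
  have h2 : z ≠ 0 := hz.2
  change (Complex.log z).re < 0
  rw [Complex.log_re]
  exact Real.log_neg (norm_pos_iff.2 h2) h1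

lemma isOpen_D : IsOpen (ball (0 : ℂ) 1 \ {0}) :=
  isOpen_ball.sdiff isClosed_singleton

lemma shift_mem {w : ℂ} (hw : w ∈ S) (n : ℤ) : w + n * (2 * Real.pi * Complex.I) ∈ S := by
  change (w + n * (2 * Real.pi * Complex.I)).re < 0
  simpa using show w.re < 0 from hw

lemma shift_mem_one {w : ℂ} (hw : w ∈ S) : w + 2 * Real.pi * Complex.I ∈ S := by
  simpa using shift_mem hw 1

lemma const_of_re_zero {L : ℂ → ℂ} (hL : DifferentiableOn ℂ L S)
    (hre : ∀ w ∈ S, (L w).re = 0) {a b : ℂ} (ha : a ∈ S) (hb : b ∈ S) : L a = L b := by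
  refine isOpen_S.is_const_of_deriv_eq_zero convex_S.isPreconnected hL ?_ ha hb
  intro w hw
  have hd : HasDerivAt L (deriv L w) w := (hL.differentiableAt (isOpen_S.mem_nhds hw)).hasDerivAt
  have h1 := Complex.reCLM.hasFDerivAt.comp w (hd.hasFDerivAt.restrictScalars ℝ)
  have h2 : HasFDerivAt (Complex.reCLM ∘ L) (0 : ℂ →L[ℝ] ℝ) w := by
    refine (hasFDerivAt_const (0 : ℝ) w).congr_of_eventuallyEq ?_
    filter_upwards [isOpen_S.mem_nhds hw] with v hv
    simpa using hre v hv
  have h3 := h1.unique h2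
  have h4 := DFunLike.congr_fun h3 1
  have h5 := DFunLike.congr_fun h3 Complex.I
  simp at h4 h5
  exact Complex.ext (by simpa using h4) (by simpa using h5)

lemma harmonicAt {u : ℂ → ℝ} {s : Set ℂ} (hs : IsOpen s) (hu : HarmonicOnC u s) {z : ℂ}
    (hz : z ∈ s) : InnerProductSpace.HarmonicAt u z := by
  have hc : ∀ w ∈ s, ContDiffAt ℝ 2 u w := fun w hw => hu.1.contDiffAt (hs.mem_nhds hw)
  refine ⟨hc z hz, ?_⟩
  filter_upwards [hs.mem_nhds hz] with w hw
  have h1 := hc w hw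
  have h2 := hu.2 w hw
  rw [fderiv_clm_apply (by fun_prop) (by fun_prop),
    fderiv_clm_apply (by fun_prop) (by fun_prop)] at h2
  simpa [InnerProductSpace.laplacian_eq_iteratedFDeriv_complexPlane,
    iteratedFDeriv_two_apply] using h2

/-- Holomorphic functions on the half plane of period `2πi` descend to the punctured disk. -/
lemma descend {F : ℂ → ℂ} (hF : DifferentiableOn ℂ F S)
    (hper : ∀ w ∈ S, F (w + 2 * Real.pi * Complex.I) = F w) :
    DifferentiableOn ℂ (fun z => F (Complex.log z)) (ball (0 : ℂ) 1 \ {0}) := by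
  have hnat : ∀ n : ℕ, ∀ w ∈ S, F (w + n * (2 * Real.pi * Complex.I)) = F w := by
    intro n
    induction n with
    | zero => simp
    | succ n ih =>
      intro w hw
      rw [← ih w hw, ← hper (w + n * (2 * Real.pi * Complex.I)) (by simpa using shift_mem hw n)]
      congr 1
      push_cast
      ring
  have hint : ∀ n : ℤ, ∀ w ∈ S, F (w + n * (2 * Real.pi * Complex.I)) = F w := by
    intro n w hw
    obtain ⟨m, rfl | rfl⟩ := n.eq_nat_or_neg
    · simpa using hnat m w hw
    · rw [← hnat m _ (shift_mem hw _)]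
      congr 1
      push_cast
      ring
  intro z hz
  refine DifferentiableAt.differentiableWithinAt ?_
  have hz0 : z ≠ 0 := hz.2
  rcases Complex.mem_slitPlane_or_neg_mem_slitPlane hz0 with h | h
  · exact (hF.differentiableAt (isOpen_S.mem_nhds (log_mem hz))).comp z
      (Complex.differentiableAt_log h)
  · have hneg : ∀ v ∈ ball (0 : ℂ) 1 \ {0}, Complex.log (-v) + Real.pi * Complex.I ∈ S := by
      intro v hv
      have : -v ∈ ball (0 : ℂ) 1 \ {0} := by simpa using hv
      have : (Complex.log (-v)).re < 0 := log_mem this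
      change (Complex.log (-v) + Real.pi * Complex.I).re < 0
      simpa using this
    have hd : DifferentiableAt ℂ (fun v => F (Complex.log (-v) + Real.pi * Complex.I)) z := by
      refine (hF.differentiableAt (isOpen_S.mem_nhds (hneg z hz))).comp z
        (f := fun v => Complex.log (-v) + Real.pi * Complex.I) ?_
      exact (differentiableAt_id.neg.clog h).add_const _
    refine hd.congr_of_eventuallyEq ?_
    filter_upwards [isOpen_D.mem_nhds hz] with v hv
    have hv0 : v ≠ 0 := hv.2
    have : Complex.exp (Complex.log v) = Complex.exp (Complex.log (-v) + Real.pi * Complex.I) := by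
      rw [Complex.exp_add, Complex.exp_log hv0, Complex.exp_log (neg_ne_zero.2 hv0),
        Complex.exp_pi_mul_I]
      ring
    obtain ⟨n, hn⟩ := Complex.exp_eq_exp_iff_exists_int.1 this
    simp only [hn]
    exact hint n _ (hneg v hv)

lemma decomposition {u : ℂ → ℝ} (hu : HarmonicOnC u (ball (0 : ℂ) 1 \ {0})) :
    ∃ (β : ℝ) (f : ℂ → ℂ), DifferentiableOn ℂ f (ball (0 : ℂ) 1 \ {0}) ∧
      ∀ z ∈ ball (0 : ℂ) 1 \ {0}, u z + β * Real.log ‖z‖ = 2 * (f z).re := by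
  set g : ℂ → ℂ := fun z => fderiv ℝ u z 1 - Complex.I * fderiv ℝ u z Complex.I with hg
  have hgd : ∀ z ∈ ball (0 : ℂ) 1 \ {0}, DifferentiableAt ℂ g z := fun z hz =>
    HarmonicAt.differentiableAt_complex_partial (harmonicAt isOpen_D hu hz)
  have hGd : DifferentiableOn ℂ (fun w => g (Complex.exp w) * Complex.exp w) S := by
    intro w hw
    refine DifferentiableAt.differentiableWithinAt ?_
    exact ((hgd _ (exp_mem hw)).comp w Complex.differentiableAt_exp).mul
      Complex.differentiableAt_exp
  obtain ⟨P, hP'⟩ := convex_S.exists_forall_hasDerivWithinAt hGd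
  have hP : ∀ w ∈ S, HasDerivAt P (g (Complex.exp w) * Complex.exp w) w := fun w hw =>
    (hP' w hw).hasDerivAt (isOpen_S.mem_nhds hw)
  have hPd : DifferentiableOn ℂ P S := fun w hw =>
    (hP w hw).differentiableAt.differentiableWithinAt
  -- the real part of the primitive
  have hD : ∀ w ∈ S, HasFDerivAt (fun w => (P w).re - u (Complex.exp w)) (0 : ℂ →L[ℝ] ℝ) w := by
    intro w hw
    have h1 := Complex.reCLM.hasFDerivAt.comp w ((hP w hw).hasFDerivAt.restrictScalars ℝ)
    have h2 : HasFDerivAt u (fderiv ℝ u (Complex.exp w)) (Complex.exp w) :=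
      ((harmonicAt isOpen_D hu (exp_mem hw)).1.differentiableAt two_ne_zero).hasFDerivAt
    have h3 := h2.comp w ((Complex.hasDerivAt_exp w).hasFDerivAt.restrictScalars ℝ)
    refine (h1.sub h3).congr_fderiv ?_
    have key : ∀ b : ℂ, fderiv ℝ u (Complex.exp w) b = (g (Complex.exp w) * b).re := by
      intro b
      conv_lhs => rw [(by simp : b = b.re • (1 : ℂ) + b.im • (Complex.I : ℂ))]
      rw [map_add, map_smul, map_smul]
      simp [hg]
      ring
    ext a
    simp [key]
    ring
  obtain ⟨K, hK⟩ : ∃ K : ℝ, ∀ w ∈ S, (P w).re = u (Complex.exp w) + K := by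
    have h0 : (-1 : ℂ) ∈ S := by simp [S]
    refine ⟨(P (-1)).re - u (Complex.exp (-1)), fun w hw => ?_⟩
    have := isOpen_S.is_const_of_fderiv_eq_zero convex_S.isPreconnected
      (fun v hv => (hD v hv).differentiableAt.differentiableWithinAt)
      (fun v hv => (hD v hv).fderiv) hw h0
    linarith
  have h0 : (-1 : ℂ) ∈ S := by simp [S]
  set C : ℂ := P (-1 + 2 * Real.pi * Complex.I) - P (-1) with hC
  have hexp : ∀ w : ℂ, Complex.exp (w + 2 * Real.pi * Complex.I) = Complex.exp w :=
    Complex.exp_periodic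
  have hre : ∀ w ∈ S, (P (w + 2 * Real.pi * Complex.I) - P w).re = 0 := by
    intro w hw
    rw [Complex.sub_re, hK _ (shift_mem_one hw), hK _ hw, hexp]
    ring
  have hCw : ∀ w ∈ S, P (w + 2 * Real.pi * Complex.I) - P w = C := by
    intro w hw
    refine const_of_re_zero (L := fun w => P (w + 2 * Real.pi * Complex.I) - P w) ?_ hre hw h0
    exact (hPd.comp (by fun_prop) (fun v hv => shift_mem_one hv)).sub hPd
  have hC0 : C.re = 0 := hre _ h0
  set c : ℝ := C.im / (2 * Real.pi) with hc
  have hCc : C = c * (2 * Real.pi * Complex.I) := by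
    have : c * (2 * Real.pi) = C.im := by rw [hc]; field_simp
    apply Complex.ext
    · simp [hC0]
    · simp [← this]
  refine ⟨-c, fun z => (P (Complex.log z) - c * Complex.log z - K) / 2, ?_, ?_⟩
  · refine descend (F := fun w => (P w - c * w - K) / 2) ?_ ?_
    · exact ((hPd.sub (by fun_prop)).sub (by fun_prop)).div_const _
    · intro w hw
      have := hCw w hw
      rw [hCc] at this
      linear_combination this / 2
  · intro z hz
    have := hK _ (log_mem hz)
    rw [Complex.exp_log hz.2] at this
    have e : ((P (Complex.log z) - c * Complex.log z - K) / 2).re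
        = ((P (Complex.log z)).re - c * Real.log ‖z‖ - K) / 2 := by
      rw [Complex.div_ofNat_re]
      simp [Complex.log_re]
    simp only [e, this]
    ring

lemma no_conjugate {b : ℝ} {g : ℂ → ℂ} (hg : DifferentiableOn ℂ g (ball (0 : ℂ) 1 \ {0}))
    (h : ∀ z ∈ ball (0 : ℂ) 1 \ {0}, b * Real.log ‖z‖ = (g z).re) : b = 0 := by
  have h0 : (-1 : ℂ) ∈ S := by simp [S]
  have hc := const_of_re_zero (L := fun w => g (Complex.exp w) - b * w)
    ((hg.comp (by fun_prop) (fun v hv => exp_mem hv)).sub (by fun_prop)) (by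
      intro w hw
      rw [Complex.sub_re, ← h _ (exp_mem hw), Complex.norm_exp, Real.log_exp]
      simp) (shift_mem_one h0) h0
  simp only [Complex.exp_periodic (-1)] at hc
  have h1 : (b : ℂ) * (2 * Real.pi * Complex.I) = 0 := by linear_combination -hc
  simpa [Real.pi_ne_zero] using h1

/-- Logarithmic form of the normalization identity. -/
lemma log_form {x γ : ℝ} (hx : 0 < x) {z a : ℂ} (hz : z ≠ 0) (k : ℤ) :
    x * (‖z ^ (-k) * Complex.exp a‖ ^ 2)⁻¹ = ‖z‖ ^ (-γ) ↔
      Real.log x + (γ + 2 * k) * Real.log ‖z‖ = 2 * a.re := by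
  have hz' : 0 < ‖z‖ := norm_pos_iff.2 hz
  have hA : 0 < ‖z ^ (-k) * Complex.exp a‖ :=
    norm_pos_iff.2 (mul_ne_zero (zpow_ne_zero _ hz) (Complex.exp_ne_zero _))
  have hl : 0 < x * (‖z ^ (-k) * Complex.exp a‖ ^ 2)⁻¹ := by positivity
  have hr : 0 < ‖z‖ ^ (-γ) := by positivity
  have hlogA : Real.log ‖z ^ (-k) * Complex.exp a‖ = -k * Real.log ‖z‖ + a.re := by
    rw [norm_mul, norm_zpow, Complex.norm_exp, Real.log_mul (by positivity) (by positivity),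
      Real.log_zpow, Real.log_exp]
    push_cast
    ring
  rw [← Real.log_injOn_pos.eq_iff hl hr, Real.log_mul hx.ne' (by positivity), Real.log_inv,
    Real.log_pow, Real.log_rpow hz', hlogA]
  push_cast
  constructor <;> intro h <;> linarith

end FlatWeight

/-- Normalization of a flat local weight: if `log h` is harmonic on the punctured disk,
there are a unique `γ ∈ [0,2)`, an integer `k` and a holomorphic function `f` on `Δ*`
such that `h · |z^{-k} e^{f}|^{-2} = |z|^{-γ}` on `Δ*`. -/
theorem flat_weight_normalization (h : ℂ → ℝ)
    (hpos : ∀ z ∈ ball (0 : ℂ) 1 \ {0}, 0 < h z)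
    (hharm : HarmonicOnC (fun z => Real.log (h z)) (ball (0 : ℂ) 1 \ {0})) :
    ∃! γ : ℝ, (0 ≤ γ ∧ γ < 2) ∧ ∃ (k : ℤ) (f : ℂ → ℂ),
      DifferentiableOn ℂ f (ball (0 : ℂ) 1 \ {0}) ∧
      ∀ z ∈ ball (0 : ℂ) 1 \ {0},
        h z * (‖z ^ (-k) * Complex.exp (f z)‖ ^ 2)⁻¹ = ‖z‖ ^ (-γ) := by
  obtain ⟨β, f, hf, hβ⟩ := FlatWeight.decomposition hharm
  have hfl := Int.floor_le (β / 2)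
  have hfl' := Int.lt_floor_add_one (β / 2)
  refine ⟨β - 2 * ⌊β / 2⌋, ⟨⟨by linarith, by linarith⟩, ⌊β / 2⌋, f, hf, ?_⟩, ?_⟩
  · intro z hz
    rw [FlatWeight.log_form (hpos z hz) hz.2, ← hβ z hz]
    ring
  · rintro γ ⟨⟨hγ0, hγ2⟩, k, f', hf', hk⟩
    have hb : (γ + 2 * k) - β = 0 := by
      refine FlatWeight.no_conjugate (g := fun z => 2 * (f' z - f z))
        ((hf'.sub hf).const_mul 2) ?_
      intro z hz
      have h1 := (FlatWeight.log_form (hpos z hz) hz.2 k).1 (hk z hz)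
      have h2 := hβ z hz
      simp only [Complex.mul_re, Complex.re_ofNat, Complex.im_ofNat, Complex.sub_re]
      linarith
    have hkf : ⌊β / 2⌋ = k := by
      rw [Int.floor_eq_iff]
      constructor <;> linarith
    rw [hkf]
    linarith
end
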